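/- arXiv:1907.07866 — 13 statements merged into one kernel-verified Lean document; each statement's English description precedes it below -/
import Mathlib

section
/- For every finite simple graph G with maximum degree Δ(G) ≥ k, where k ≥ 2 is an integer, the k-domination number satisfies γ_k(G) ≥ γ(G) + k − 2. -/
/-- A set `D` is a `k`-dominating set of `G` if every vertex outside `D`
has at least `k` neighbors in `D`. -/
def kDomSet {V : Type*} (G : SimpleGraph V) (k : ℕ) (D : Set V) : Prop :=
  ∀ v ∉ D, k ≤ (D ∩ G.neighborSet v).ncard

/-- The `k`-domination number: minimum size of a `k`-dominating set. -/
noncomputable def kDomNum {V : Type*} [Fintype V] (G : SimpleGraph V) (k : ℕ) : ℕ :=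
  sInf {n | ∃ D : Set V, kDomSet G k D ∧ D.ncard = n}

/-- For any graph `G` with `Δ(G) ≥ k ≥ 2`, we have `γ_k(G) ≥ γ(G) + k - 2`. -/
theorem stmt_0 {V : Type*} [Fintype V] (G : SimpleGraph V) [DecidableRel G.Adj]
    (k : ℕ) (hk : 2 ≤ k) (hΔ : k ≤ G.maxDegree) :
    kDomNum G 1 + k - 2 ≤ kDomNum G k := by
  obtain ⟨D, hD, hcard⟩ : ∃ D : Set V, kDomSet G k D ∧ D.ncard = kDomNum G k := by
    have hne : {n | ∃ D : Set V, kDomSet G k D ∧ D.ncard = n}.Nonempty :=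
      ⟨_, Set.univ, fun v hv => absurd (Set.mem_univ v) hv, rfl⟩
    exact Nat.sInf_mem hne
  obtain ⟨v, hv⟩ : ∃ v, k ≤ (D ∩ G.neighborSet v).ncard := by
    by_cases h : ∃ v, v ∉ D
    · obtain ⟨v, hv⟩ := h
      exact ⟨v, hD v hv⟩
    · push Not at h
      have hne : Nonempty V := by
        by_contra hE
        rw [not_nonempty_iff] at hE
        have : G.maxDegree = 0 := by simp
        omega
      obtain ⟨v, hv⟩ := G.exists_maximal_degree_vertex
      refine ⟨v, ?_⟩
      have hu : D = Set.univ := Set.eq_univ_of_forall h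
      rw [hu, Set.univ_inter, Set.ncard_eq_toFinset_card']
      rw [hv] at hΔ
      exact hΔ
  obtain ⟨S, hS, hSc⟩ := Set.exists_subset_card_eq (show k - 1 ≤ (D ∩ G.neighborSet v).ncard by omega)
  have hdom : kDomSet G 1 (insert v (D \ S)) := by
    intro u hu
    refine Nat.succ_le_of_lt ((Set.ncard_pos (Set.toFinite _)).2 ?_)
    by_cases huS : u ∈ S
    · exact ⟨v, Set.mem_insert _ _, (hS huS).2.symm⟩
    · have huD : u ∉ D := fun h => hu (Set.mem_insert_of_mem _ ⟨h, huS⟩)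
      have h1 := hD u huD
      obtain ⟨w, hw, hwS⟩ := Set.exists_mem_notMem_of_ncard_lt_ncard
        (show S.ncard < (D ∩ G.neighborSet u).ncard by omega) (Set.toFinite _)
      exact ⟨w, Set.mem_insert_of_mem _ ⟨hw.1, hwS⟩, hw.2⟩
  have h1 : kDomNum G 1 ≤ (insert v (D \ S)).ncard := Nat.sInf_le ⟨_, hdom, rfl⟩
  have h2 := Set.ncard_insert_le v (D \ S)
  have h3 := Set.ncard_sdiff_add_ncard_of_subset (fun x hx => (hS hx).1 : S ⊆ D) (Set.toFinite _)
  omega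
end

section
/- If G is a connected finite simple graph with at least two vertices and γ₂(G) = γ(G), then the minimum degree of G is at least 2. -/
theorem exists_ne_of_two_le {V : Type*} [Finite V] {S : Set V} (h : 2 ≤ S.ncard) (a : V) :
    ∃ b ∈ S, b ≠ a := by
  exact Set.exists_ne_of_one_lt_ncard h a

theorem one_le_of_mem {V : Type*} [Finite V] {S : Set V} {a : V} (h : a ∈ S) :
    1 ≤ S.ncard := by
  have : 0 < S.ncard := (Set.ncard_pos (Set.toFinite S)).2 ⟨a, h⟩
  exact this

/-- If `G` is a connected nontrivial graph with `γ₂(G) = γ(G)`, then `δ(G) ≥ 2`. -/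
theorem stmt_1 {V : Type*} [Fintype V] (G : SimpleGraph V) [DecidableRel G.Adj]
    (hconn : G.Connected) (hcard : 2 ≤ Fintype.card V)
    (heq : kDomNum G 2 = kDomNum G 1) :
    2 ≤ G.minDegree := by
  classical
  have : Nontrivial V := Fintype.one_lt_card_iff_nontrivial.1 hcard
  by_contra hlt
  obtain ⟨v, hv⟩ := G.exists_minimal_degree_vertex
  have hpos : 0 < G.degree v := hconn.preconnected.degree_pos_of_nontrivial v
  have h1 : G.degree v = 1 := by omega
  obtain ⟨u, huv, huniq⟩ := G.degree_eq_one_iff_existsUnique_adj.1 h1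
  obtain ⟨D, hD, hDc⟩ : kDomNum G 2 ∈ {n | ∃ D : Set V, kDomSet G 2 D ∧ D.ncard = n} :=
    Nat.sInf_mem ⟨_, Set.univ, fun x hx => absurd (Set.mem_univ x) hx, rfl⟩
  have hmin : ∀ E : Set V, kDomSet G 1 E → D.ncard ≤ E.ncard := by
    intro E hE
    rw [hDc, heq]
    exact Nat.sInf_le ⟨E, hE, rfl⟩
  have hvD : v ∈ D := by
    by_contra hvD
    obtain ⟨b, hb, hbu⟩ := exists_ne_of_two_le (hD v hvD) u
    exact hbu (huniq b hb.2)
  by_cases huD : u ∈ D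
  · have := hmin (D \ {v}) (by
      intro x hx
      by_cases hxv : x = v
      · subst hxv
        exact one_le_of_mem (a := u) ⟨⟨huD, fun h => huv.ne h.symm⟩, huv⟩
      · have hxD : x ∉ D := fun h => hx ⟨h, hxv⟩
        obtain ⟨b, hb, hbv⟩ := exists_ne_of_two_le (hD x hxD) v
        exact one_le_of_mem (a := b) ⟨⟨hb.1, hbv⟩, hb.2⟩)
    have := Set.ncard_sdiff_singleton_lt_of_mem hvD (Set.toFinite D)
    omega
  · obtain ⟨w, hw, hwv⟩ := exists_ne_of_two_le (hD u huD) v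
    have h2 := hmin (insert u ((D \ {v}) \ {w})) (by
      intro x hx
      have hxu : x ≠ u := fun h => hx (Or.inl h)
      by_cases hxv : x = v
      · subst hxv
        exact one_le_of_mem (a := u) ⟨Or.inl rfl, huv⟩
      by_cases hxw : x = w
      · subst hxw
        exact one_le_of_mem (a := u) ⟨Or.inl rfl, G.adj_symm hw.2⟩
      have hxD : x ∉ D := fun h => hx (Or.inr ⟨⟨h, hxv⟩, hxw⟩)
      obtain ⟨b, hb, hbw⟩ := exists_ne_of_two_le (hD x hxD) w
      refine one_le_of_mem (a := b) ⟨Or.inr ⟨⟨hb.1, ?_⟩, hbw⟩, hb.2⟩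
      rintro rfl
      exact hxu (huniq x (G.adj_symm hb.2)))
    have h3 := Set.ncard_sdiff_singleton_lt_of_mem hvD (Set.toFinite D)
    have h4 := Set.ncard_sdiff_singleton_lt_of_mem (show w ∈ D \ {v} from ⟨hw.1, hwv⟩)
      (Set.toFinite _)
    have h5 := Set.ncard_insert_le u ((D \ {v}) \ {w})
    omega
end

section
/- Let D be a minimum 2-dominating set of a finite simple graph G. If γ₂(G) = γ(G), then D is an independent set of G (no two vertices of D are adjacent). -/
/-- If `D` is a minimum 2-dominating set of `G` and `γ₂(G) = γ(G)`,
then `D` is independent. -/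
theorem stmt_2 {V : Type*} [Fintype V] (G : SimpleGraph V) (D : Set V)
    (hD : kDomSet G 2 D) (hmin : D.ncard = kDomNum G 2)
    (heq : kDomNum G 2 = kDomNum G 1) :
    ∀ u ∈ D, ∀ v ∈ D, ¬ G.Adj u v := by
  intro u hu v hv huv
  have hdom : kDomSet G 1 (D \ {u}) := by
    intro w hw
    by_cases hwD : w ∈ D
    · have hwu : w = u := by
        by_contra h
        exact hw ⟨hwD, h⟩
      subst hwu
      have hne : ((D \ {w}) ∩ G.neighborSet w).Nonempty :=
        ⟨v, ⟨hv, fun h => huv.ne h.symm⟩, huv⟩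
      exact (Set.ncard_pos (Set.toFinite _)).2 hne
    · have h2 := hD w hwD
      have h3 := Set.pred_ncard_le_ncard_diff_singleton (D ∩ G.neighborSet w) u
      have h4 : (D \ {u}) ∩ G.neighborSet w = (D ∩ G.neighborSet w) \ {u} := by
        ext x
        simp only [Set.mem_inter_iff, Set.mem_diff]
        tauto
      rw [h4]
      omega
  have hle : kDomNum G 1 ≤ (D \ {u}).ncard := Nat.sInf_le ⟨_, hdom, rfl⟩
  have hlt := Set.ncard_diff_singleton_lt_of_mem hu (Set.toFinite D)
  omega
end

section
/- Let G be a connected finite simple graph with at least two vertices satisfying γ₂(G) = γ(G), and let D be a minimum 2-dominating set of G. Then for every vertex u' ∉ D and every pair of vertices u, v ∈ D that are both adjacent to u', there exists a vertex v' ∉ D such that the four vertices u, u', v, v' induce a 4-cycle in G (that is, u' and v' are both adjacent to u and to v, u is not adjacent to v, and u' is not adjacent to v'). -/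
/-- Let `G` be a connected nontrivial graph with `γ₂(G) = γ(G)` and let `D` be
a minimum 2-dominating set. Then for each `u' ∉ D` and distinct `u, v ∈ D` both
adjacent to `u'`, there is `v' ∉ D` such that `u, u', v, v'` induce a 4-cycle. -/
theorem stmt_3 {V : Type*} [Fintype V] (G : SimpleGraph V)
    (hconn : G.Connected) (hcard : 2 ≤ Fintype.card V)
    (heq : kDomNum G 2 = kDomNum G 1)
    (D : Set V) (hD : kDomSet G 2 D) (hmin : D.ncard = kDomNum G 2) :
    ∀ u' ∉ D, ∀ u ∈ D, ∀ v ∈ D, u ≠ v → G.Adj u' u → G.Adj u' v →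
      ∃ v' ∉ D, v' ≠ u' ∧ G.Adj v' u ∧ G.Adj v' v ∧ ¬ G.Adj u v ∧ ¬ G.Adj u' v' := by
  have key : ∀ S : Set V, (∀ x ∉ S, ∃ w ∈ S, G.Adj x w) → D.ncard ≤ S.ncard := by
    intro S hS
    rw [hmin, heq]
    refine Nat.sInf_le ⟨S, ?_, rfl⟩
    intro x hx
    obtain ⟨w, hw, ha⟩ := hS x hx
    exact (Set.ncard_pos (Set.toFinite _)).2 ⟨w, hw, ha⟩
  have nb : ∀ x ∉ D, ∀ a, ∃ w ∈ D, w ≠ a ∧ G.Adj x w := by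
    intro x hx a
    obtain ⟨w, hw, hne⟩ := Set.exists_ne_of_one_lt_ncard (hD x hx) a
    exact ⟨w, hw.1, hne, hw.2⟩
  intro u' hu' u hu v hv huv hau hav
  have hnot : ¬ G.Adj u v := by
    intro h
    have h1 := key (D \ {u}) (by
      intro x hx
      by_cases hxu : x = u
      · subst hxu
        exact ⟨v, ⟨hv, fun h => huv h.symm⟩, h⟩
      · have hxD : x ∉ D := fun h => hx ⟨h, hxu⟩
        obtain ⟨w, hw, hne, ha⟩ := nb x hxD u
        exact ⟨w, ⟨hw, hne⟩, ha⟩)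
    have h2 := Set.ncard_diff_singleton_lt_of_mem hu (Set.toFinite D)
    omega
  by_contra hcon
  have h1 := key (insert u' ((D \ {u}) \ {v})) (by
    intro x hx
    by_cases hxu : x = u
    · subst hxu
      exact ⟨u', Or.inl rfl, hau.symm⟩
    by_cases hxv : x = v
    · subst hxv
      exact ⟨u', Or.inl rfl, hav.symm⟩
    have hxD : x ∉ D := fun h => hx (Or.inr ⟨⟨h, hxu⟩, hxv⟩)
    have hxu' : x ≠ u' := fun h => hx (Or.inl h)
    by_contra hno
    have hno' : ∀ w ∈ D, G.Adj x w → w = u ∨ w = v := by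
      intro w hw ha
      by_contra hc
      push Not at hc
      exact hno ⟨w, Or.inr ⟨⟨hw, hc.1⟩, hc.2⟩, ha⟩
    obtain ⟨w, hw, hne, ha⟩ := nb x hxD u
    obtain ⟨z, hz, hnez, haz⟩ := nb x hxD v
    have e1 : w = v := (hno' w hw ha).resolve_left hne
    have e2 : z = u := (hno' z hz haz).resolve_right hnez
    subst e1 e2
    exact hcon ⟨x, hxD, hxu', haz, ha, hnot, fun h => hno ⟨u', Or.inl rfl, h.symm⟩⟩)
  have h2 := Set.ncard_diff_singleton_lt_of_mem hu (Set.toFinite D)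
  have h3 : v ∈ D \ {u} := ⟨hv, fun h => huv h.symm⟩
  have h4 := Set.ncard_diff_singleton_lt_of_mem h3 (Set.toFinite _)
  have h5 := Set.ncard_insert_le u' ((D \ {u}) \ {v})
  omega
end

section
/- Let G be a connected finite simple graph with at least two vertices satisfying γ₂(G) = γ(G), and let D be a minimum 2-dominating set of G. Then for every pair of vertices u, v ∈ D having at least one common neighbor in G, there exist two non-adjacent vertices u', v' ∈ V(G) ∖ D such that N_G(u') ∩ D = N_G(v') ∩ D = {u, v}. -/
theorem aux_small {V : Type*} [Fintype V] (G : SimpleGraph V) (D E : Set V)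
    (hmin : D.ncard = kDomNum G 1) (hE : E.ncard < D.ncard) :
    ∃ z ∉ E, ∀ x ∈ E, ¬ G.Adj z x := by
  by_contra! h
  have h1 : kDomNum G 1 ≤ E.ncard := by
    apply Nat.sInf_le
    refine ⟨E, fun z hz => ?_, rfl⟩
    obtain ⟨x, hx, hzx⟩ := h z hz
    exact (Set.ncard_pos (Set.toFinite _)).2 ⟨x, hx, hzx⟩
  omega

theorem aux_two {V : Type*} [Fintype V] (G : SimpleGraph V) (D : Set V)
    (hD : kDomSet G 2 D) (z : V) (hz : z ∉ D) :
    ∃ a ∈ D, ∃ b ∈ D, a ≠ b ∧ G.Adj z a ∧ G.Adj z b := by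
  have h := hD z hz
  obtain ⟨a, ha, b, hb, hab⟩ := (Set.one_lt_ncard (Set.toFinite _)).1 h
  exact ⟨a, ha.1, b, hb.1, hab, ha.2, hb.2⟩

theorem aux_step {V : Type*} [Fintype V] (G : SimpleGraph V) (D : Set V)
    (hD : kDomSet G 2 D) (hmin : D.ncard = kDomNum G 1) (u v w : V)
    (hu : u ∈ D) (hv : v ∈ D) (huv : u ≠ v) (hwu : G.Adj w u) (hwv : G.Adj w v) :
    ∃ z ∉ D, w ≠ z ∧ ¬ G.Adj w z ∧ G.neighborSet z ∩ D = {u, v} ∧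
      G.Adj z u ∧ G.Adj z v := by
  have hcard : (insert w ((D \ {u}) \ {v})).ncard < D.ncard := by
    have h1 := Set.ncard_insert_le w ((D \ {u}) \ {v})
    have h2 := Set.ncard_sdiff_singleton_add_one hu (Set.toFinite D)
    have h3 := Set.ncard_sdiff_singleton_add_one
      (show v ∈ D \ {u} from ⟨hv, fun h => huv h.symm⟩) (Set.toFinite _)
    omega
  obtain ⟨z, hz, hzE⟩ := aux_small G D _ hmin hcard
  have hzw : ¬ G.Adj z w := hzE w (Set.mem_insert _ _)
  have hzne : z ≠ w := fun h => hz (h ▸ Set.mem_insert _ _)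
  have hx : ∀ x ∈ D, G.Adj z x → x = u ∨ x = v := by
    intro x hxD hzx
    by_contra! hne
    exact hzE x (Set.mem_insert_of_mem _ ⟨⟨hxD, hne.1⟩, hne.2⟩) hzx
  have hzD : z ∉ D := by
    intro hzD
    have : z ≠ u := fun h => hzw (h ▸ hwu.symm)
    have : z ≠ v := fun h => hzw (h ▸ hwv.symm)
    exact hz (Set.mem_insert_of_mem _ ⟨⟨hzD, by assumption⟩, by assumption⟩)
  obtain ⟨a, ha, b, hb, hab, hza, hzb⟩ := aux_two G D hD z hzD
  have h2 : G.Adj z u ∧ G.Adj z v := by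
    rcases hx a ha hza with rfl | rfl <;> rcases hx b hb hzb with rfl | rfl <;> simp_all
  refine ⟨z, hzD, hzne.symm, fun h => hzw h.symm, ?_, h2⟩
  ext x
  constructor
  · rintro ⟨h, h'⟩
    exact hx x h' h
  · rintro (rfl | rfl)
    · exact ⟨h2.1, hu⟩
    · exact ⟨h2.2, hv⟩

/-- Let `G` be a connected nontrivial graph with `γ₂(G) = γ(G)` and let `D` be a
minimum 2-dominating set. For every pair `u, v ∈ D` with a common neighbor, there
is a nonadjacent pair `u', v' ∉ D` with `N(u') ∩ D = N(v') ∩ D = {u, v}`. -/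
theorem stmt_4 {V : Type*} [Fintype V] (G : SimpleGraph V)
    (hconn : G.Connected) (hcard : 2 ≤ Fintype.card V)
    (heq : kDomNum G 2 = kDomNum G 1)
    (D : Set V) (hD : kDomSet G 2 D) (hmin : D.ncard = kDomNum G 2) :
    ∀ u ∈ D, ∀ v ∈ D, u ≠ v → (G.neighborSet u ∩ G.neighborSet v).Nonempty →
      ∃ u' ∉ D, ∃ v' ∉ D, u' ≠ v' ∧ ¬ G.Adj u' v' ∧
        G.neighborSet u' ∩ D = {u, v} ∧ G.neighborSet v' ∩ D = {u, v} := by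
  rintro u hu v hv huv ⟨w, hwu, hwv⟩
  have hm := hmin.trans heq
  obtain ⟨z, hz, -, -, hN, hzu, hzv⟩ :=
    aux_step G D hD hm u v w hu hv huv (SimpleGraph.Adj.symm hwu) (SimpleGraph.Adj.symm hwv)
  obtain ⟨y, hy, hne, hadj, hN', -, -⟩ := aux_step G D hD hm u v z hu hv huv hzu hzv
  exact ⟨z, hz, y, hy, hne, hadj, hN, hN'⟩
end

section
/- Let F be any finite simple graph, and let G_F be the graph obtained as follows: take a 4-cycle on new vertices u, a, v, b (with edges ua, av, vb, bu) disjoint from F, keep all edges of F, and join every vertex of F to both u and v. Then F is an induced subgraph of G_F and γ(G_F) = γ₂(G_F) = 2. Consequently, every finite simple graph occurs as an induced subgraph of some graph satisfying γ = γ₂. -/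
universe u

/-- The graph `G_F`: a 4-cycle `u a v b` on the four new vertices
`Sum.inr 0, Sum.inr 1, Sum.inr 2, Sum.inr 3` (with `u = Sum.inr 0`, `v = Sum.inr 2`),
all edges of `F` kept, and every vertex of `F` joined to both `u` and `v`. -/
def GF {V : Type u} (F : SimpleGraph V) : SimpleGraph (V ⊕ Fin 4) :=
  SimpleGraph.fromRel (fun a b =>
    match a, b with
    | Sum.inl x, Sum.inl y => F.Adj x y
    | Sum.inl _, Sum.inr i => i = 0 ∨ i = 2
    | Sum.inr _, Sum.inl _ => False
    | Sum.inr i, Sum.inr j =>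
        (i = 0 ∧ j = 1) ∨ (i = 1 ∧ j = 2) ∨ (i = 2 ∧ j = 3) ∨ (i = 3 ∧ j = 0))

theorem GF_ll {V : Type u} (F : SimpleGraph V) (x y : V) :
    (GF F).Adj (Sum.inl x) (Sum.inl y) ↔ F.Adj x y := by
  simp only [GF, SimpleGraph.fromRel_adj]
  constructor
  · rintro ⟨_, h | h⟩
    · exact h
    · exact h.symm
  · intro h
    exact ⟨fun e => h.ne (Sum.inl.inj e), Or.inl h⟩

theorem GF_l {V : Type u} (F : SimpleGraph V) (x : V) (i : Fin 4) :
    (GF F).Adj (Sum.inl x) (Sum.inr i) ↔ (i = 0 ∨ i = 2) := by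
  simp [GF, SimpleGraph.fromRel_adj]

theorem GF_rr {V : Type u} (F : SimpleGraph V) (i j : Fin 4) :
    (GF F).Adj (Sum.inr i) (Sum.inr j) ↔ (i.val + j.val) % 2 = 1 := by
  simp only [GF, SimpleGraph.fromRel_adj, ne_eq, Sum.inr.injEq]
  revert i j
  decide

theorem kDomSet_mono {V : Type*} (G : SimpleGraph V) (D : Set V)
    (h : kDomSet G 2 D) : kDomSet G 1 D :=
  fun v hv => le_trans (by norm_num) (h v hv)

theorem GF_dom {V : Type u} (F : SimpleGraph V) :
    kDomSet (GF F) 2 {Sum.inr 0, Sum.inr 2} := by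
  have hc : ({Sum.inr 0, Sum.inr 2} : Set (V ⊕ Fin 4)).ncard = 2 :=
    Set.ncard_pair (by simp)
  intro w hw
  have hs : ({Sum.inr 0, Sum.inr 2} : Set (V ⊕ Fin 4)) ⊆ (GF F).neighborSet w := by
    intro z hz
    rw [SimpleGraph.mem_neighborSet]
    simp only [Set.mem_insert_iff, Set.mem_singleton_iff] at hz hw
    rcases w with x | i
    · rcases hz with rfl | rfl <;> simp [GF_l]
    · simp only [Sum.inr.injEq] at hw
      rcases hz with rfl | rfl <;> rw [GF_rr] <;> revert i <;> decide
  rw [Set.inter_eq_left.mpr hs, hc]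

theorem GF_lower {V : Type u} [Fintype V] (F : SimpleGraph V) (D : Set (V ⊕ Fin 4))
    (h : kDomSet (GF F) 1 D) : 2 ≤ D.ncard := by
  by_contra hlt
  have hle : D.ncard ≤ 1 := by omega
  have hsub := (Set.ncard_le_one (Set.toFinite D)).mp hle
  have key : ∀ w, w ∈ D ∨ ∃ z ∈ D, (GF F).Adj w z := by
    intro w
    by_cases hw : w ∈ D
    · exact Or.inl hw
    · right
      have h1 := h w hw
      obtain ⟨z, hz⟩ := (Set.ncard_pos (Set.toFinite _)).mp h1
      exact ⟨z, hz.1, hz.2⟩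
  have hex : ∃ z, z ∈ D := by
    rcases key (Sum.inr 0) with h | ⟨z, hz, _⟩
    · exact ⟨_, h⟩
    · exact ⟨z, hz⟩
  obtain ⟨z, hz⟩ := hex
  have key2 : ∀ w, w = z ∨ (GF F).Adj w z := by
    intro w
    rcases key w with h | ⟨y, hy, ha⟩
    · exact Or.inl (hsub _ h _ hz)
    · right
      rwa [hsub _ hz _ hy]
  rcases z with x | i
  · have := key2 (Sum.inr 1)
    rw [SimpleGraph.adj_comm, GF_l] at this
    simp at this
  · have k := fun j : Fin 4 => key2 (Sum.inr j)
    simp only [GF_rr, Sum.inr.injEq] at k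
    clear key2 hz
    revert i
    decide

theorem GF_num {V : Type u} [Fintype V] (F : SimpleGraph V) (k : ℕ)
    (h1 : ∀ D, kDomSet (GF F) k D → kDomSet (GF F) 1 D)
    (h2 : kDomSet (GF F) k {Sum.inr 0, Sum.inr 2}) : kDomNum (GF F) k = 2 := by
  have hm : 2 ∈ {n | ∃ D : Set (V ⊕ Fin 4), kDomSet (GF F) k D ∧ D.ncard = n} :=
    ⟨_, h2, Set.ncard_pair (by simp)⟩
  apply le_antisymm (Nat.sInf_le hm)
  apply le_csInf ⟨2, hm⟩
  rintro n ⟨D, hD, rfl⟩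
  exact GF_lower F D (h1 D hD)

/-- `F` is an induced subgraph of `G_F` and `γ(G_F) = γ₂(G_F) = 2`; consequently,
every finite simple graph occurs as an induced subgraph of some graph with `γ = γ₂`. -/
theorem stmt_5 {V : Type u} [Fintype V] (F : SimpleGraph V) :
    Nonempty (F ↪g GF F) ∧ kDomNum (GF F) 1 = 2 ∧ kDomNum (GF F) 2 = 2 ∧
      ∃ (W : Type u) (fW : Fintype W) (G : SimpleGraph W),
        Nonempty (F ↪g G) ∧ @kDomNum W fW G 1 = @kDomNum W fW G 2 := by
  have he : Nonempty (F ↪g GF F) :=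
    ⟨⟨⟨Sum.inl, Sum.inl_injective⟩, fun {x y} => GF_ll F x y⟩⟩
  have n1 : kDomNum (GF F) 1 = 2 :=
    GF_num F 1 (fun _ h => h) (kDomSet_mono _ _ (GF_dom F))
  have n2 : kDomNum (GF F) 2 = 2 :=
    GF_num F 2 (fun _ h => kDomSet_mono _ _ h) (GF_dom F)
  exact ⟨he, n1, n2, V ⊕ Fin 4, inferInstance, GF F, he, n1.trans n2.symm⟩
end

section
/- Let G be a finite simple graph and let D ⊆ V(G) be an independent set such that every vertex of V(G) ∖ D has exactly two neighbors in D. Then D is a minimum 2-dominating set of G; in particular γ₂(G) = |D|. -/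
/-- If `D` is an independent set such that every vertex outside `D` has exactly
two neighbors in `D`, then `D` is a minimum 2-dominating set; in particular
`γ₂(G) = |D|`. -/
theorem stmt_6 {V : Type*} [Fintype V] (G : SimpleGraph V) (D : Set V)
    (hind : ∀ u ∈ D, ∀ v ∈ D, ¬ G.Adj u v)
    (htwo : ∀ x ∉ D, (D ∩ G.neighborSet x).ncard = 2) :
    kDomSet G 2 D ∧ kDomNum G 2 = D.ncard := by
  classical
  have hD : kDomSet G 2 D := fun x hx => (htwo x hx).ge
  refine ⟨hD, le_antisymm (Nat.sInf_le ⟨D, hD, rfl⟩) ?_⟩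
  refine le_csInf ⟨_, D, hD, rfl⟩ ?_
  rintro n ⟨S, hS, rfl⟩
  have key : (D \ S).toFinset.card * 2 ≤ (S \ D).toFinset.card * 2 := by
    apply Finset.card_mul_le_card_mul (fun a b => G.Adj a b)
    · intro a ha
      simp only [Set.mem_toFinset, Set.mem_diff] at ha
      refine (hS a ha.2).trans ?_
      rw [← Set.ncard_coe_finset]
      refine Set.ncard_le_ncard ?_ (Set.toFinite _)
      rintro b ⟨hb, hab⟩
      have hab' : G.Adj a b := hab
      have hbD : b ∉ D := fun h => hind a ha.1 b h hab'
      simp [Finset.bipartiteAbove, hb, hbD, hab']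
    · intro b hb
      simp only [Set.mem_toFinset, Set.mem_diff] at hb
      rw [← htwo b hb.2, ← Set.ncard_coe_finset]
      refine Set.ncard_le_ncard ?_ (Set.toFinite _)
      intro a ha
      simp only [Finset.bipartiteBelow, Finset.coe_filter, Set.mem_toFinset, Set.mem_diff,
        Set.mem_setOf_eq] at ha
      exact ⟨ha.1.1, ha.2.symm⟩
  rw [← Set.ncard_eq_toFinset_card', ← Set.ncard_eq_toFinset_card'] at key
  have h1 := Set.ncard_inter_add_ncard_diff_eq_ncard D S (Set.toFinite _)
  have h2 := Set.ncard_inter_add_ncard_diff_eq_ncard S D (Set.toFinite _)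
  rw [Set.inter_comm] at h2
  omega
end

section
/- Let G be a finite simple graph with γ₂(G) = γ(G) and let D be a minimum 2-dominating set of G. Then: (i) D is an independent set in G; (ii) every vertex outside D has at least two neighbors in D; and (iii) for every pair u, v ∈ D having a common neighbor in G, there exist two non-adjacent vertices x, x' ∈ V(G) ∖ D with N_G(x) ∩ D = N_G(x') ∩ D = {u, v}. (This establishes that G belongs to the class 𝒢 with underlying graph F = G²[D], where G²[D] is the graph on D in which two vertices are adjacent exactly when they have a common neighbor in G.) -/
theorem aux_le {V : Type*} [Fintype V] (G : SimpleGraph V)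
    (heq : kDomNum G 2 = kDomNum G 1)
    (D : Set V) (hmin : D.ncard = kDomNum G 2) (E : Set V)
    (hE : ∀ x ∉ E, ∃ y ∈ E, G.Adj x y) : D.ncard ≤ E.ncard := by
  rw [hmin, heq]
  apply Nat.sInf_le
  refine ⟨E, ?_, rfl⟩
  intro x hx
  obtain ⟨y, hy, hxy⟩ := hE x hx
  exact (Set.ncard_pos (Set.toFinite _)).2 ⟨y, hy, hxy⟩

/-- If `γ₂(G) = γ(G)` and `D` is a minimum 2-dominating set, then `D` is
independent, every vertex outside `D` has at least two neighbors in `D`, and for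
every pair `u, v ∈ D` having a common neighbor there are two nonadjacent vertices
`x, x' ∉ D` with `N(x) ∩ D = N(x') ∩ D = {u, v}` (so `G ∈ 𝒢` with underlying
graph `G²[D]`). -/
theorem stmt_7 {V : Type*} [Fintype V] (G : SimpleGraph V)
    (heq : kDomNum G 2 = kDomNum G 1)
    (D : Set V) (hD : kDomSet G 2 D) (hmin : D.ncard = kDomNum G 2) :
    (∀ u ∈ D, ∀ v ∈ D, ¬ G.Adj u v) ∧
    (∀ x ∉ D, 2 ≤ (D ∩ G.neighborSet x).ncard) ∧
    (∀ u ∈ D, ∀ v ∈ D, u ≠ v → (G.neighborSet u ∩ G.neighborSet v).Nonempty →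
      ∃ x ∉ D, ∃ x' ∉ D, x ≠ x' ∧ ¬ G.Adj x x' ∧
        G.neighborSet x ∩ D = {u, v} ∧ G.neighborSet x' ∩ D = {u, v}) := by
  have hle := aux_le G heq D hmin
  have hind : ∀ u ∈ D, ∀ v ∈ D, ¬ G.Adj u v := by
    intro u hu v hv huv
    have h1 := hle (D \ {u}) (by
      intro x hx
      by_cases hxu : x = u
      · subst hxu
        exact ⟨v, ⟨hv, fun h => huv.ne h.symm⟩, huv⟩
      · have hxD : x ∉ D := fun h => hx ⟨h, hxu⟩
        obtain ⟨y, hy, hyu⟩ := Set.exists_ne_of_one_lt_ncard (hD x hxD) u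
        exact ⟨y, ⟨hy.1, hyu⟩, hy.2⟩)
    have h2 := Set.ncard_sdiff_singleton_add_one hu (Set.toFinite D)
    omega
  refine ⟨hind, hD, ?_⟩
  intro u hu v hv huv ⟨w, hwu, hwv⟩
  by_contra hcon
  obtain ⟨y, hyu, hyv, hyX⟩ : ∃ y, G.Adj u y ∧ G.Adj v y ∧
      ∀ x ∉ D, G.neighborSet x ∩ D = {u, v} → x ≠ y → G.Adj x y := by
    by_cases hX : ∃ y ∉ D, G.neighborSet y ∩ D = {u, v}
    · obtain ⟨y, hyD, hy⟩ := hX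
      have h1 : u ∈ G.neighborSet y ∩ D := by rw [hy]; simp
      have h2 : v ∈ G.neighborSet y ∩ D := by rw [hy]; simp
      refine ⟨y, G.adj_symm h1.1, G.adj_symm h2.1, ?_⟩
      intro x hxD hx hxy
      by_contra hn
      exact hcon ⟨x, hxD, y, hyD, hxy, hn, hx, hy⟩
    · exact ⟨w, hwu, hwv, fun x hxD hx _ => (hX ⟨x, hxD, hx⟩).elim⟩
  have h1 := hle (insert y (D \ {u, v})) (by
    intro x hx
    have hxy : x ≠ y := fun h => hx (Or.inl h)
    by_cases hxu : x = u
    · exact ⟨y, Or.inl rfl, hxu ▸ hyu⟩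
    by_cases hxv : x = v
    · exact ⟨y, Or.inl rfl, hxv ▸ hyv⟩
    have hxD : x ∉ D := fun h => hx (Or.inr ⟨h, by simp [hxu, hxv]⟩)
    by_cases hs : D ∩ G.neighborSet x ⊆ {u, v}
    · have he := Set.eq_of_subset_of_ncard_le hs
        (by rw [Set.ncard_pair huv]; exact hD x hxD) (Set.toFinite _)
      exact ⟨y, Or.inl rfl, hyX x hxD (by rw [Set.inter_comm]; exact he) hxy⟩
    · obtain ⟨z, hz, hzn⟩ := Set.not_subset.1 hs
      exact ⟨z, Or.inr ⟨hz.1, hzn⟩, hz.2⟩)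
  have h2 := Set.ncard_insert_le y (D \ {u, v})
  have h3 := Set.ncard_sdiff_add_ncard_of_subset (s := {u, v}) (t := D)
    (by rintro z (rfl | rfl) <;> assumption) (Set.toFinite _)
  rw [Set.ncard_pair huv] at h3
  omega
end

section
/- Let F be a finite simple graph containing no cycle of length 3 or 4, let G ∈ 𝒢₂(F) with specified set D = V(F). Then γ(G) = γ₂(G) holds if and only if G^D contains no subgraph isomorphic to B^W and no subgraph isomorphic to A_k^W for any integer k ≥ 2. -/
/-- `G` with specified set `D` belongs to the class `𝒢₂(F)` for the underlying
graph `F` on vertex set `D` whose edges are the pairs `{u,v} ⊆ D` admitting a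
subdivision vertex: `D` is independent; every vertex outside `D` has its
`D`-neighborhood equal to some pair `{u,v}` of distinct vertices of `D`; every
pair of distinct vertices of `D` has exactly 0 or exactly 2 such subdivision
vertices; and two subdivision vertices of the same pair are never adjacent. -/
def memG2 {V : Type*} (G : SimpleGraph V) (D : Set V) : Prop :=
  (∀ u ∈ D, ∀ v ∈ D, ¬ G.Adj u v) ∧
  (∀ x ∉ D, ∃ u ∈ D, ∃ v ∈ D, u ≠ v ∧ G.neighborSet x ∩ D = {u, v}) ∧
  (∀ u ∈ D, ∀ v ∈ D, u ≠ v →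
    {x | x ∉ D ∧ G.neighborSet x ∩ D = {u, v}}.ncard = 0 ∨
    {x | x ∉ D ∧ G.neighborSet x ∩ D = {u, v}}.ncard = 2) ∧
  (∀ x ∉ D, ∀ y ∉ D, G.neighborSet x ∩ D = G.neighborSet y ∩ D → ¬ G.Adj x y)

/-- Adjacency in the underlying graph `F`: two distinct vertices of `D` joined
by at least one subdivision vertex. -/
def underAdj {V : Type*} (G : SimpleGraph V) (D : Set V) (u v : V) : Prop :=
  u ∈ D ∧ v ∈ D ∧ u ≠ v ∧ ∃ x, x ∉ D ∧ G.neighborSet x ∩ D = {u, v}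

/-- The underlying graph contains no cycle of length 3 and no cycle of length 4. -/
def underNoC3C4 {V : Type*} (G : SimpleGraph V) (D : Set V) : Prop :=
  (¬ ∃ a b c : V, underAdj G D a b ∧ underAdj G D b c ∧ underAdj G D a c) ∧
  (¬ ∃ a b c d : V, a ≠ b ∧ a ≠ c ∧ a ≠ d ∧ b ≠ c ∧ b ≠ d ∧ c ≠ d ∧
      underAdj G D a b ∧ underAdj G D b c ∧ underAdj G D c d ∧ underAdj G D d a)

/-- `G^D` contains a subgraph isomorphic to `H^W`: an injective map carrying
edges of `H` to edges of `G` and carrying exactly `W` into `D`. -/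
def containsDSub {VH VG : Type*} (H : SimpleGraph VH) (W : Set VH)
    (G : SimpleGraph VG) (D : Set VG) : Prop :=
  ∃ φ : VH → VG, Function.Injective φ ∧
    (∀ a b, H.Adj a b → G.Adj (φ a) (φ b)) ∧ ∀ a, φ a ∈ D ↔ a ∈ W

/-- Vertex type of `A_k`: `Sum.inl none = v`, `Sum.inl (some i) = wᵢ`,
`Sum.inr (i, false) = xᵢ¹`, `Sum.inr (i, true) = xᵢ²`. -/
abbrev AkV (k : ℕ) := Option (Fin k) ⊕ (Fin k × Bool)

/-- The graph `A_k`: edges `v xᵢ¹, v xᵢ², wᵢ xᵢ¹, wᵢ xᵢ²` and the cyclic edges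
`xᵢ¹ x_{i+1 (mod k)}²`. -/
def Agraph (k : ℕ) : SimpleGraph (AkV k) :=
  SimpleGraph.fromRel (fun a b =>
    match a, b with
    | Sum.inl none, Sum.inr _ => True
    | Sum.inl (some i), Sum.inr (j, _) => i = j
    | Sum.inr (i, false), Sum.inr (j, true) => (j : ℕ) = ((i : ℕ) + 1) % k
    | _, _ => False)

/-- The specified set `W = {v, w₁, …, w_k}` of `A_k`. -/
def AW (k : ℕ) : Set (AkV k) := Set.range Sum.inl

/-- Vertex type of `B`: `Sum.inl (i, false) = v_{i+1}`, `Sum.inl (i, true) = u_{i+1}`,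
`Sum.inr (i, false) = x_{i+1}¹`, `Sum.inr (i, true) = x_{i+1}²`. -/
abbrev BV := (Fin 2 × Bool) ⊕ (Fin 2 × Bool)

/-- The graph `B`: edges `vᵢ xᵢ¹, vᵢ xᵢ², uᵢ xᵢ¹, uᵢ xᵢ²` for `i = 1, 2`,
together with the edge `x₁¹ x₂¹`. -/
def Bgraph : SimpleGraph BV :=
  SimpleGraph.fromRel (fun a b =>
    match a, b with
    | Sum.inl (i, _), Sum.inr (j, _) => i = j
    | Sum.inr (i, false), Sum.inr (j, false) => i ≠ j
    | _, _ => False)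

/-- The specified set `W = {v₁, u₁, v₂, u₂}` of `B`. -/
def BW : Set BV := Set.range Sum.inl

namespace StmtAux

variable {V : Type*} [Fintype V] {G : SimpleGraph V} {D : Set V}

lemma nbr_iff {x : V} {s : Set V} (h : G.neighborSet x ∩ D = s) (u : V) :
    u ∈ s ↔ G.Adj x u ∧ u ∈ D := by
  rw [← h]; simp

lemma nb_eq (hG : memG2 G D) {x u v : V} (hx : x ∉ D) (hu : u ∈ D) (hv : v ∈ D) (huv : u ≠ v)
    (h1 : G.Adj x u) (h2 : G.Adj x v) : G.neighborSet x ∩ D = {u, v} := by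
  obtain ⟨a, ha, b, hb, hab, h⟩ := hG.2.1 x hx
  have e1 : u ∈ ({a, b} : Set V) := (nbr_iff h u).2 ⟨h1, hu⟩
  have e2 : v ∈ ({a, b} : Set V) := (nbr_iff h v).2 ⟨h2, hv⟩
  rw [h]
  simp only [Set.mem_insert_iff, Set.mem_singleton_iff] at e1 e2
  rcases e1 with rfl | rfl <;> rcases e2 with rfl | rfl <;> simp_all [Set.pair_comm]

lemma twin_exists (hG : memG2 G D) (x : V) (hx : x ∉ D) :
    ∃ x', x' ∉ D ∧ x' ≠ x ∧ G.neighborSet x' ∩ D = G.neighborSet x ∩ D ∧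
      ∀ y, y ∉ D → G.neighborSet y ∩ D = G.neighborSet x ∩ D → y = x ∨ y = x' := by
  obtain ⟨a, ha, b, hb, hab, h⟩ := hG.2.1 x hx
  have hmem : x ∈ {x | x ∉ D ∧ G.neighborSet x ∩ D = {a, b}} := ⟨hx, h⟩
  rcases hG.2.2.1 a ha b hb hab with h0 | h2
  · rw [Set.ncard_eq_zero] at h0
    rw [h0] at hmem; exact hmem.elim
  · obtain ⟨p, q, hpq, e⟩ := Set.ncard_eq_two.1 h2
    have key : ∀ y, (y ∉ D ∧ G.neighborSet y ∩ D = {a, b}) ↔ y = p ∨ y = q := by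
      intro y
      have := Set.ext_iff.1 e y
      simpa using this
    rcases (key x).1 ⟨hx, h⟩ with rfl | rfl
    · have := (key q).2 (Or.inr rfl)
      exact ⟨q, this.1, hpq.symm, this.2.trans h.symm, fun y hy hy' => (key y).1 ⟨hy, hy'.trans h⟩⟩
    · have := (key p).2 (Or.inl rfl)
      exact ⟨p, this.1, hpq, this.2.trans h.symm,
        fun y hy hy' => ((key y).1 ⟨hy, hy'.trans h⟩).symm⟩

lemma dom_iff {S : Set V} : kDomSet G 1 S ↔ ∀ v ∉ S, ∃ w ∈ S, G.Adj v w := by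
  unfold kDomSet
  refine forall₂_congr fun v _ => ?_
  rw [Nat.one_le_iff_ne_zero, ← Nat.pos_iff_ne_zero, Set.ncard_pos]
  rfl

lemma two_dom (hG : memG2 G D) : kDomSet G 2 D := by
  intro x hx
  obtain ⟨a, ha, b, hb, hab, h⟩ := hG.2.1 x hx
  rw [Set.inter_comm, h, Set.ncard_pair hab]

lemma card_le_of_two_dom (hG : memG2 G D) {S : Set V} (hS : kDomSet G 2 S) :
    D.ncard ≤ S.ncard := by
  classical
  have key := Finset.card_mul_le_card_mul (s := (D \ S).toFinset) (t := (S \ D).toFinset)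
    (fun a b => G.Adj a b) (m := 2) (n := 2) ?_ ?_
  · have h1 : (D \ S).ncard ≤ (S \ D).ncard := by
      rw [Set.ncard_eq_toFinset_card', Set.ncard_eq_toFinset_card']; omega
    have e1 := Set.ncard_inter_add_ncard_sdiff_eq_ncard D S
    have e2 := Set.ncard_inter_add_ncard_sdiff_eq_ncard S D
    rw [Set.inter_comm] at e2
    omega
  · intro a ha
    simp only [Set.mem_toFinset, Set.mem_sdiff] at ha
    refine (hS a ha.2).trans ?_
    rw [Set.ncard_eq_toFinset_card']
    refine Finset.card_le_card ?_
    intro y hy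
    simp only [Set.mem_toFinset, Set.mem_inter_iff, SimpleGraph.mem_neighborSet] at hy
    simp only [Finset.bipartiteAbove, Finset.mem_filter, Set.mem_toFinset, Set.mem_sdiff]
    exact ⟨⟨hy.1, fun hyD => hG.1 a ha.1 y hyD hy.2⟩, hy.2⟩
  · intro b hb
    simp only [Set.mem_toFinset, Set.mem_sdiff] at hb
    obtain ⟨p, hp, q, hq, hpq, h⟩ := hG.2.1 b hb.2
    refine (Finset.card_le_card (t := {p, q}) ?_).trans Finset.card_le_two
    intro y hy
    simp only [Finset.bipartiteBelow, Finset.mem_filter, Set.mem_toFinset, Set.mem_sdiff] at hy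
    have := (nbr_iff h y).2 ⟨hy.2.symm, hy.1.1⟩
    simpa using this

lemma gamma_two (hG : memG2 G D) : kDomNum G 2 = D.ncard := by
  apply le_antisymm
  · exact Nat.sInf_le ⟨D, two_dom hG, rfl⟩
  · refine le_csInf ⟨_, D, two_dom hG, rfl⟩ ?_
    rintro n ⟨S, hS, rfl⟩
    exact card_le_of_two_dom hG hS

lemma gamma_eq_iff (hG : memG2 G D) : kDomNum G 1 = kDomNum G 2 ↔
    ¬ ∃ S : Set V, kDomSet G 1 S ∧ S.ncard < D.ncard := by
  have hD : kDomSet G 1 D := fun v hv => le_trans (by norm_num) (two_dom hG v hv)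
  rw [gamma_two hG]
  constructor
  · rintro h ⟨S, hS, hlt⟩
    have : kDomNum G 1 ≤ S.ncard := Nat.sInf_le ⟨S, hS, rfl⟩
    omega
  · intro h
    apply le_antisymm
    · exact Nat.sInf_le ⟨D, hD, rfl⟩
    · refine le_csInf ⟨_, D, hD, rfl⟩ ?_
      rintro n ⟨S, hS, rfl⟩
      by_contra hlt
      exact h ⟨S, hS, not_le.1 hlt⟩

lemma swap_dom (C E : Set V) (hC : C ⊆ D) (hcard : E.ncard < C.ncard)
    (h1 : ∀ c ∈ C, ∃ e ∈ E, G.Adj c e)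
    (h2 : ∀ x ∉ D, x ∈ E ∨ (∃ w, (w ∈ D ∧ w ∉ C) ∧ G.Adj x w) ∨ ∃ e ∈ E, G.Adj x e) :
    ∃ S : Set V, kDomSet G 1 S ∧ S.ncard < D.ncard := by
  refine ⟨(D \ C) ∪ E, dom_iff.2 ?_, ?_⟩
  · intro v hv
    by_cases hD : v ∈ D
    · have : v ∈ C := by
        by_contra hc
        exact hv (Or.inl ⟨hD, hc⟩)
      obtain ⟨e, he, ha⟩ := h1 v this
      exact ⟨e, Or.inr he, ha⟩
    · rcases h2 v hD with h | ⟨w, hw, ha⟩ | ⟨e, he, ha⟩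
      · exact (hv (Or.inr h)).elim
      · exact ⟨w, Or.inl hw, ha⟩
      · exact ⟨e, Or.inr he, ha⟩
  · have := Set.ncard_union_le (D \ C) E
    have := Set.ncard_sdiff_add_ncard_of_subset hC
    omega

lemma B_core (hG : memG2 G D) {a b c d x1 x2 y : V} (ha : a ∈ D) (hb : b ∈ D) (hd : d ∈ D)
    (hab : a ≠ b) (had : a ≠ d) (hbd : b ≠ d)
    (hx1 : x1 ∉ D) (hx2 : x2 ∉ D) (hx : x1 ≠ x2)
    (n1 : G.neighborSet x1 ∩ D = {a, b}) (n2 : G.neighborSet x2 ∩ D = {a, b})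
    (ny : G.neighborSet y ∩ D = {c, d}) (hadj : G.Adj x1 y)
    (u1 : ¬ underAdj G D a d) (u2 : ¬ underAdj G D b d) :
    ∃ S : Set V, kDomSet G 1 S ∧ S.ncard < D.ncard := by
  refine swap_dom {a, b, d} {x2, y} ?_ ?_ ?_ ?_
  · rintro z (rfl | rfl | rfl) <;> assumption
  · have h3 : ({a, b, d} : Set V).ncard = 3 := by
      rw [Set.ncard_eq_three]
      exact ⟨a, b, d, hab, had, hbd, rfl⟩
    have := Set.ncard_insert_le x2 ({y} : Set V)
    rw [Set.ncard_singleton] at this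
    omega
  · rintro z (rfl | rfl | rfl)
    · exact ⟨x2, by simp, (((nbr_iff n2 z).1 (by simp)).1).symm⟩
    · exact ⟨x2, by simp, (((nbr_iff n2 z).1 (by simp)).1).symm⟩
    · exact ⟨y, by simp, (((nbr_iff ny z).1 (by simp)).1).symm⟩
  · intro x hxD
    obtain ⟨p, hp, q, hq, hpq, h⟩ := hG.2.1 x hxD
    by_cases hpC : p ∈ ({a, b, d} : Set V)
    swap
    · exact Or.inr (Or.inl ⟨p, ⟨hp, hpC⟩, ((nbr_iff h p).1 (by simp)).1⟩)
    by_cases hqC : q ∈ ({a, b, d} : Set V)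
    swap
    · exact Or.inr (Or.inl ⟨q, ⟨hq, hqC⟩, ((nbr_iff h q).1 (by simp)).1⟩)
    have fin : G.neighborSet x ∩ D = {a, b} → x ∈ ({x2, y} : Set V) ∨
        (∃ w, (w ∈ D ∧ w ∉ ({a, b, d} : Set V)) ∧ G.Adj x w) ∨
          ∃ e ∈ ({x2, y} : Set V), G.Adj x e := by
      intro hn
      obtain ⟨x', -, -, -, hall⟩ := twin_exists hG x hxD
      have e1 := hall x1 hx1 (n1.trans hn.symm)
      have e2 := hall x2 hx2 (n2.trans hn.symm)
      by_cases e : x = x1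
      · subst e
        exact Or.inr (Or.inr ⟨y, by simp, hadj⟩)
      · left
        rcases e1 with e1 | e1
        · exact (e e1.symm).elim
        · rcases e2 with e2 | e2
          · simp [e2]
          · exact (hx (e1.trans e2.symm)).elim
    have h' : G.neighborSet x ∩ D = {q, p} := by rw [h, Set.pair_comm]
    simp only [Set.mem_insert_iff, Set.mem_singleton_iff] at hpC hqC
    rcases hpC with rfl | rfl | rfl <;> rcases hqC with rfl | rfl | rfl
    · exact (hpq rfl).elim
    · exact fin h
    · exact (u1 ⟨hp, hq, hpq, x, hxD, h⟩).elim
    · exact fin h'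
    · exact (hpq rfl).elim
    · exact (u2 ⟨hp, hq, hpq, x, hxD, h⟩).elim
    · exact (u1 ⟨hq, hp, hpq.symm, x, hxD, h'⟩).elim
    · exact (u2 ⟨hq, hp, hpq.symm, x, hxD, h'⟩).elim
    · exact (hpq rfl).elim

lemma under_symm {a b : V} (h : underAdj G D a b) : underAdj G D b a := by
  obtain ⟨h1, h2, h3, x, hx, h4⟩ := h
  exact ⟨h2, h1, h3.symm, x, hx, by rw [h4, Set.pair_comm]⟩

lemma of_B (hG : memG2 G D) (hF : underNoC3C4 G D) (h : containsDSub Bgraph BW G D) :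
    ∃ S : Set V, kDomSet G 1 S ∧ S.ncard < D.ncard := by
  obtain ⟨φ, inj, hadj, hmem⟩ := h
  have hl : ∀ z, φ (Sum.inl z) ∈ D := fun z => (hmem _).2 ⟨z, rfl⟩
  have hr : ∀ z, φ (Sum.inr z) ∉ D := fun z hz => by
    obtain ⟨w, hw⟩ := (hmem _).1 hz
    simp at hw
  have hn : ∀ i c, G.neighborSet (φ (Sum.inr (i, c))) ∩ D =
      {φ (Sum.inl (i, false)), φ (Sum.inl (i, true))} := by
    intro i c
    refine nb_eq hG (hr _) (hl _) (hl _) (inj.ne (by simp)) ?_ ?_ <;>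
    · apply hadj
      simp [Bgraph, SimpleGraph.fromRel_adj]
  have hxy : G.Adj (φ (Sum.inr (0, false))) (φ (Sum.inr (1, false))) := by
    apply hadj
    simp [Bgraph, SimpleGraph.fromRel_adj]
  have hne : ∀ z w, z ≠ w → φ (Sum.inl z) ≠ φ (Sum.inl w) := fun z w hzw =>
    inj.ne (by simpa using hzw)
  have n1 := hn 0 false
  have n2 := hn 0 true
  have ny := hn 1 false
  have ab := hne (0, false) (0, true) (by decide)
  have ac := hne (0, false) (1, false) (by decide)
  have ad := hne (0, false) (1, true) (by decide)
  have bc := hne (0, true) (1, false) (by decide)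
  have bd := hne (0, true) (1, true) (by decide)
  have cd := hne (1, false) (1, true) (by decide)
  have hx : φ (Sum.inr (0, false)) ≠ φ (Sum.inr (0, true)) := inj.ne (by simp)
  have ha := hl (0, false)
  have hb := hl (0, true)
  have hc := hl (1, false)
  have hd := hl (1, true)
  have hx1 := hr (0, false)
  have hx2 := hr (0, true)
  have hy := hr (1, false)
  generalize φ (Sum.inl (0, false)) = a at *
  generalize φ (Sum.inl (0, true)) = b at *
  generalize φ (Sum.inl (1, false)) = c at *
  generalize φ (Sum.inl (1, true)) = d at *
  have uab : underAdj G D a b := ⟨ha, hb, ab, _, hx1, n1⟩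
  have ucd : underAdj G D c d := ⟨hc, hd, cd, _, hy, ny⟩
  by_cases hcase : underAdj G D a d ∨ underAdj G D b d
  · have ny' := ny
    rw [Set.pair_comm] at ny'
    refine B_core hG ha hb hc ab ac bc hx1 hx2 hx n1 n2 ny' hxy ?_ ?_
    · intro uac
      rcases hcase with uad | ubd
      · exact hF.1 ⟨a, c, d, uac, ucd, uad⟩
      · exact hF.2 ⟨a, c, d, b, ac, ad, ab, cd, bc.symm, bd.symm, uac, ucd, under_symm ubd,
          under_symm uab⟩
    · intro ubc
      rcases hcase with uad | ubd
      · exact hF.2 ⟨a, b, c, d, ab, ac, ad, bc, bd, cd, uab, ubc, ucd, under_symm uad⟩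
      · exact hF.1 ⟨b, c, d, ubc, ucd, ubd⟩
  · push Not at hcase
    exact B_core hG ha hb hd ab ad bd hx1 hx2 hx n1 n2 ny hxy hcase.1 hcase.2

lemma of_A (hG : memG2 G D) (hF : underNoC3C4 G D) (k : ℕ) (hk : 2 ≤ k)
    (h : containsDSub (Agraph k) (AW k) G D) :
    ∃ S : Set V, kDomSet G 1 S ∧ S.ncard < D.ncard := by
  obtain ⟨φ, inj, hadj, hmem⟩ := h
  have hl : ∀ z, φ (Sum.inl z) ∈ D := fun z => (hmem _).2 ⟨z, rfl⟩
  have hr : ∀ z, φ (Sum.inr z) ∉ D := fun z hz => by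
    obtain ⟨w, hw⟩ := (hmem _).1 hz
    simp at hw
  have av : ∀ i c, G.Adj (φ (Sum.inr (i, c))) (φ (Sum.inl none)) := by
    intro i c
    apply hadj
    simp [Agraph, SimpleGraph.fromRel_adj]
  have aw : ∀ i c, G.Adj (φ (Sum.inr (i, c))) (φ (Sum.inl (some i))) := by
    intro i c
    apply hadj
    simp [Agraph, SimpleGraph.fromRel_adj]
  have hn : ∀ i c, G.neighborSet (φ (Sum.inr (i, c))) ∩ D =
      {φ (Sum.inl none), φ (Sum.inl (some i))} := fun i c =>
    nb_eq hG (hr _) (hl _) (hl _) (inj.ne (by simp)) (av i c) (aw i c)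
  have hpred : ∀ j : Fin k, ∃ i : Fin k, G.Adj (φ (Sum.inr (j, true))) (φ (Sum.inr (i, false))) := by
    intro j
    have hj := j.2
    refine ⟨⟨((j : ℕ) + (k - 1)) % k, Nat.mod_lt _ (by omega)⟩, ?_⟩
    apply SimpleGraph.Adj.symm
    apply hadj
    have : (j : ℕ) = (((j : ℕ) + (k - 1)) % k + 1) % k := by
      rw [Nat.mod_add_mod, show (j : ℕ) + (k - 1) + 1 = j + k by omega, Nat.add_mod_right,
        Nat.mod_eq_of_lt hj]
    simp only [Agraph, SimpleGraph.fromRel_adj]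
    exact ⟨by simp, Or.inl this⟩
  have uvw : ∀ i, underAdj G D (φ (Sum.inl none)) (φ (Sum.inl (some i))) := fun i =>
    ⟨hl _, hl _, inj.ne (by simp), _, hr (i, false), hn i false⟩
  refine swap_dom (Set.range fun z => φ (Sum.inl z)) (Set.range fun i => φ (Sum.inr (i, false)))
    ?_ ?_ ?_ ?_
  · rintro _ ⟨z, rfl⟩; exact hl z
  · have i1 : Function.Injective fun z : Option (Fin k) => φ (Sum.inl z) :=
      inj.comp Sum.inl_injective
    have i2 : Function.Injective fun i : Fin k => φ (Sum.inr (i, false)) := by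
      intro a b hab
      have := inj hab
      simpa using this
    rw [← Set.image_univ, ← Set.image_univ, Set.ncard_image_of_injective _ i1,
      Set.ncard_image_of_injective _ i2, Set.ncard_univ, Set.ncard_univ]
    simp
  · rintro _ ⟨z, rfl⟩
    rcases z with _ | i
    · exact ⟨_, ⟨⟨0, by omega⟩, rfl⟩, (av _ _).symm⟩
    · exact ⟨_, ⟨i, rfl⟩, (aw _ _).symm⟩
  · intro x hxD
    obtain ⟨p, hp, q, hq, hpq, h⟩ := hG.2.1 x hxD
    by_cases hpC : p ∈ (Set.range fun z => φ (Sum.inl z))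
    swap
    · exact Or.inr (Or.inl ⟨p, ⟨hp, hpC⟩, ((nbr_iff h p).1 (by simp)).1⟩)
    by_cases hqC : q ∈ (Set.range fun z => φ (Sum.inl z))
    swap
    · exact Or.inr (Or.inl ⟨q, ⟨hq, hqC⟩, ((nbr_iff h q).1 (by simp)).1⟩)
    have fin : ∀ i, G.neighborSet x ∩ D = {φ (Sum.inl none), φ (Sum.inl (some i))} →
        x ∈ (Set.range fun i => φ (Sum.inr (i, false))) ∨
        (∃ w, (w ∈ D ∧ w ∉ (Set.range fun z => φ (Sum.inl z))) ∧ G.Adj x w) ∨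
          ∃ e ∈ (Set.range fun i => φ (Sum.inr (i, false))), G.Adj x e := by
      intro i hi
      obtain ⟨x', -, -, -, hall⟩ := twin_exists hG x hxD
      have e1 := hall _ (hr (i, false)) ((hn i false).trans hi.symm)
      have e2 := hall _ (hr (i, true)) ((hn i true).trans hi.symm)
      rcases e1 with e1 | e1
      · exact Or.inl ⟨i, e1⟩
      · rcases e2 with e2 | e2
        · obtain ⟨j, hj⟩ := hpred i
          exact Or.inr (Or.inr ⟨_, ⟨j, rfl⟩, e2 ▸ hj⟩)
        · have := inj (e1.trans e2.symm)
          simp at this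
    obtain ⟨p, rfl⟩ := hpC
    obtain ⟨q, rfl⟩ := hqC
    rcases p with _ | i <;> rcases q with _ | j
    · exact (hpq rfl).elim
    · exact fin j h
    · exact fin i (h.trans (Set.pair_comm _ _))
    · exact (hF.1 ⟨_, _, _, uvw i, ⟨hp, hq, hpq, x, hxD, h⟩, uvw j⟩).elim

lemma B_of_adj (hG : memG2 G D) {x y : V} (hx : x ∉ D) (hy : y ∉ D) (hxy : G.Adj x y)
    (hno : ∀ u ∈ D, G.Adj x u → ¬ G.Adj y u) : containsDSub Bgraph BW G D := by
  obtain ⟨a, ha, b, hb, hab, h1⟩ := hG.2.1 x hx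
  obtain ⟨c, hc, d, hd, hcd, h2⟩ := hG.2.1 y hy
  obtain ⟨x', hx', hxx, n1, -⟩ := twin_exists hG x hx
  obtain ⟨y', hy', hyy, n2, -⟩ := twin_exists hG y hy
  have xa := ((nbr_iff h1 a).1 (by simp)).1
  have xb := ((nbr_iff h1 b).1 (by simp)).1
  have yc := ((nbr_iff h2 c).1 (by simp)).1
  have yd := ((nbr_iff h2 d).1 (by simp)).1
  have xa' := ((nbr_iff (n1.trans h1) a).1 (by simp)).1
  have xb' := ((nbr_iff (n1.trans h1) b).1 (by simp)).1
  have yc' := ((nbr_iff (n2.trans h2) c).1 (by simp)).1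
  have yd' := ((nbr_iff (n2.trans h2) d).1 (by simp)).1
  have ac : a ≠ c := by rintro rfl; exact hno _ ha xa yc
  have ad : a ≠ d := by rintro rfl; exact hno _ ha xa yd
  have bc : b ≠ c := by rintro rfl; exact hno _ hb xb yc
  have bd : b ≠ d := by rintro rfl; exact hno _ hb xb yd
  have nxy : ∀ z w, G.neighborSet z ∩ D = G.neighborSet x ∩ D →
      G.neighborSet w ∩ D = G.neighborSet y ∩ D → z ≠ w := by
    rintro z _ e1 e2 rfl
    have := (nbr_iff (e2.symm.trans (e1.trans h1)) a).1 (by simp)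
    exact hno a ha xa this.1
  have e1 := nxy x y rfl rfl
  have e2 := nxy x y' rfl n2
  have e3 := nxy x' y n1 rfl
  have e4 := nxy x' y' n1 n2
  have hDX : ∀ u v, u ∈ D → v ∉ D → u ≠ v := by
    rintro u _ h1 h2 rfl; exact h2 h1
  let dd : Fin 2 × Bool → V := fun z => if z.1 = 0 then (if z.2 then b else a) else
    (if z.2 then d else c)
  let ee : Fin 2 × Bool → V := fun z => if z.1 = 0 then (if z.2 then x' else x) else
    (if z.2 then y' else y)
  have ddD : ∀ z, dd z ∈ D := by
    rintro ⟨i, _ | _⟩ <;> fin_cases i <;> simpa [dd]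
  have eeD : ∀ z, ee z ∉ D := by
    rintro ⟨i, _ | _⟩ <;> fin_cases i <;> simpa [ee]
  have ddi : Function.Injective dd := by
    rintro ⟨i, _ | _⟩ ⟨j, _ | _⟩ hh <;> fin_cases i <;> fin_cases j <;> simp [dd] at hh ⊢ <;>
      simp_all
  have eei : Function.Injective ee := by
    rintro ⟨i, _ | _⟩ ⟨j, _ | _⟩ hh <;> fin_cases i <;> fin_cases j <;> simp [ee] at hh ⊢ <;>
      simp_all
  have hde : ∀ i b c, G.Adj (ee (i, c)) (dd (i, b)) := by
    intro i b c
    fin_cases i <;> cases b <;> cases c <;> simpa [dd, ee]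
  have hee : ∀ i j, i ≠ j → G.Adj (ee (i, false)) (ee (j, false)) := by
    intro i j hij
    fin_cases i <;> fin_cases j <;> simp [ee] at hij ⊢
    · exact hxy
    · exact hxy.symm
  refine ⟨Sum.elim dd ee, ddi.sumElim eei fun z w => hDX _ _ (ddD z) (eeD w), ?_, ?_⟩
  · rintro (⟨i, _ | _⟩ | ⟨i, _ | _⟩) (⟨j, _ | _⟩ | ⟨j, _ | _⟩) hh <;>
      simp only [Bgraph, SimpleGraph.fromRel_adj] at hh <;>
      simp only [Sum.elim_inl, Sum.elim_inr] <;>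
      first
      | (obtain rfl : i = j := by simpa [eq_comm] using hh.2
         first | exact hde _ _ _ | exact (hde _ _ _).symm)
      | exact hee _ _ (by simpa [eq_comm] using hh.2)
      | simp at hh
  · rintro (z | z)
    · simp [BW, ddD]
    · simp [BW, eeD]

lemma exists_cycle {α : Type*} [Finite α] (f : α → α) (x0 : α) :
    ∃ y, y ∈ Function.periodicPts f := by
  obtain ⟨m, n, hmn, h⟩ := Finite.exists_ne_map_eq_of_infinite (fun n : ℕ => f^[n] x0)
  wlog hlt : m < n generalizing m n
  · exact this n m hmn.symm h.symm (by omega)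
  refine ⟨f^[m] x0, Function.mk_mem_periodicPts (n := n - m) (by omega) ?_⟩
  show f^[n - m] (f^[m] x0) = f^[m] x0
  rw [← Function.iterate_add_apply, Nat.sub_add_cancel hlt.le]
  exact h.symm

lemma A_of_cycle (hG : memG2 G D) (T : Set V) (hT : ∀ x ∈ T, x ∉ D) (r : V) (hr : r ∈ D)
    (x0 : V) (hx0 : x0 ∈ T) (hx0r : G.Adj x0 r) (tw : V → V)
    (htw : ∀ x, x ∉ D → tw x ∉ D ∧ tw x ≠ x ∧ G.neighborSet (tw x) ∩ D = G.neighborSet x ∩ D ∧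
      ∀ y, y ∉ D → G.neighborSet y ∩ D = G.neighborSet x ∩ D → y = x ∨ y = tw x)
    (hstep : ∀ x ∈ T, G.Adj x r → tw x ∉ T ∧ ∃ y ∈ T, G.Adj y r ∧ G.Adj (tw x) y) :
    ∃ k, 2 ≤ k ∧ containsDSub (Agraph k) (AW k) G D := by
  classical
  let α := {x : V // x ∈ T ∧ G.Adj x r}
  have hstep' : ∀ x : α, ∃ y : α, G.Adj (tw x) y := by
    rintro ⟨x, hx, hxr⟩
    obtain ⟨-, y, h1, h2, h3⟩ := hstep x hx hxr
    exact ⟨⟨y, h1, h2⟩, h3⟩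
  choose f hf using hstep'
  obtain ⟨y, hy⟩ := exists_cycle f ⟨x0, hx0, hx0r⟩
  have hother : ∀ x : α, ∃ w, w ∈ D ∧ w ≠ r ∧ G.neighborSet x ∩ D = {r, w} := by
    rintro ⟨x, hx, hxr⟩
    obtain ⟨a, ha, b, hb, hab, h⟩ := hG.2.1 x (hT x hx)
    have : r ∈ ({a, b} : Set V) := (nbr_iff h r).2 ⟨hxr, hr⟩
    rcases this with rfl | h'
    · exact ⟨b, hb, hab.symm, h⟩
    · obtain rfl : r = b := h'
      exact ⟨a, ha, hab, h.trans (Set.pair_comm _ _)⟩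
  choose w hwD hwr hw using hother
  have hkpos : 0 < Function.minimalPeriod f y := Function.minimalPeriod_pos_of_mem_periodicPts hy
  have hfne : ∀ x, f x ≠ x := by
    intro x hx
    have h1 := hf x
    rw [hx] at h1
    have hxD := hT x x.2.1
    exact hG.2.2.2 _ (htw x hxD).1 _ hxD (htw x hxD).2.2.1 h1
  have hk : 2 ≤ Function.minimalPeriod f y := by
    by_contra hlt
    have h1 : Function.minimalPeriod f y = 1 := by omega
    rw [Function.minimalPeriod_eq_one_iff_isFixedPt] at h1
    exact hfne y h1
  have hxs : ∀ i j, i < Function.minimalPeriod f y → j < Function.minimalPeriod f y →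
      f^[i] y = f^[j] y → i = j := fun i j hi hj h =>
    Function.iterate_injOn_Iio_minimalPeriod hi hj h
  have hmod : ∀ i, f^[i % Function.minimalPeriod f y] y = f^[i] y := fun i =>
    Function.iterate_mod_minimalPeriod_eq
  generalize Function.minimalPeriod f y = k at *
  have hxD : ∀ x : α, (x : V) ∉ D := fun x => hT x x.2.1
  have htT : ∀ x : α, tw x ∉ T := fun x => (hstep x x.2.1 x.2.2).1
  have same : ∀ x z : α, G.neighborSet x ∩ D = G.neighborSet z ∩ D → x = z := by
    intro x z h
    rcases (htw z (hxD z)).2.2.2 x (hxD x) h with h' | h'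
    · exact Subtype.ext h'
    · exact (htT z (h' ▸ x.2.1)).elim
  have adjr : ∀ x : α, G.Adj (tw x) r ∧ G.Adj (tw x) (w x) ∧ G.Adj x (w x) := by
    intro x
    have hn := (htw x (hxD x)).2.2.1.trans (hw x)
    exact ⟨((nbr_iff hn r).1 (by simp)).1, ((nbr_iff hn _).1 (by simp)).1,
      ((nbr_iff (hw x) _).1 (by simp)).1⟩
  refine ⟨k, hk, fun z => match z with
    | Sum.inl none => r
    | Sum.inl (some i) => w (f^[(i : ℕ)] y)
    | Sum.inr (i, false) => tw (f^[(i : ℕ)] y)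
    | Sum.inr (i, true) => (f^[(i : ℕ)] y : α), ?_, ?_, ?_⟩
  · have winj : ∀ x z, w x = w z → x = z := by
      intro x z h
      apply same
      rw [hw, hw, h]
    have tinj : ∀ x z : α, tw x = tw z → x = z := by
      intro x z h
      apply same
      rw [← (htw x (hxD x)).2.2.1, ← (htw z (hxD z)).2.2.1, h]
    rintro ((_ | i) | ⟨i, _ | _⟩) ((_ | j) | ⟨j, _ | _⟩) hh <;> simp only at hh
    · rfl
    · exact (hwr _ hh.symm).elim
    · exact ((htw _ (hxD _)).1 (hh ▸ hr)).elim
    · exact ((hxD _) (hh ▸ hr)).elim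
    · exact (hwr _ hh).elim
    · rw [Fin.ext (hxs i j i.2 j.2 (winj _ _ hh))]
    · exact ((htw _ (hxD _)).1 (hh ▸ hwD _)).elim
    · exact ((hxD _) (hh ▸ hwD _)).elim
    · exact ((htw _ (hxD _)).1 (hh ▸ hr)).elim
    · exact ((htw _ (hxD _)).1 (hh ▸ hwD _)).elim
    · rw [Fin.ext (hxs i j i.2 j.2 (tinj _ _ hh))]
    · exact (htT _ (hh ▸ (f^[(j : ℕ)] y).2.1)).elim
    · exact ((hxD _) (hh ▸ hr)).elim
    · exact ((hxD _) (hh ▸ hwD _)).elim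
    · exact (htT _ (hh ▸ (f^[(i : ℕ)] y).2.1)).elim
    · rw [Fin.ext (hxs i j i.2 j.2 (Subtype.ext hh))]
  · have cyc : ∀ i j : Fin k, (j : ℕ) = ((i : ℕ) + 1) % k →
        G.Adj (tw (f^[(i : ℕ)] y)) (f^[(j : ℕ)] y : α) := by
      intro i j h
      rw [h, hmod, Function.iterate_succ_apply']
      exact hf _
    rintro ((_ | i) | ⟨i, _ | _⟩) ((_ | j) | ⟨j, _ | _⟩) hh <;>
      simp [Agraph, SimpleGraph.fromRel_adj] at hh ⊢
    · exact (adjr _).1.symm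
    · exact (f^[(j : ℕ)] y).2.2.symm
    · subst hh; exact (adjr _).2.1.symm
    · subst hh; exact (adjr _).2.2.symm
    · exact (adjr _).1
    · subst hh; exact (adjr _).2.1
    · exact cyc i j hh
    · exact (f^[(i : ℕ)] y).2.2
    · subst hh; exact (adjr _).2.2
    · exact (cyc j i hh).symm
  · rintro ((_ | i) | ⟨i, _ | _⟩) <;> simp [AW]
    · exact hr
    · exact hwD _
    · exact (htw _ (hxD _)).1
    · exact hxD _

lemma converse (hG : memG2 G D) (hB : ¬ containsDSub Bgraph BW G D)
    (S : Set V) (hS : kDomSet G 1 S) (hlt : S.ncard < D.ncard) :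
    ∃ k, 2 ≤ k ∧ containsDSub (Agraph k) (AW k) G D := by
  classical
  rw [dom_iff] at hS
  have htw0 : ∀ x, ∃ x', x ∉ D → x' ∉ D ∧ x' ≠ x ∧
      G.neighborSet x' ∩ D = G.neighborSet x ∩ D ∧
      ∀ y, y ∉ D → G.neighborSet y ∩ D = G.neighborSet x ∩ D → y = x ∨ y = x' := by
    intro x
    by_cases hx : x ∈ D
    · exact ⟨x, fun h => (h hx).elim⟩
    · obtain ⟨x', h⟩ := twin_exists hG x hx
      exact ⟨x', fun _ => h⟩
  choose tw htw using htw0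
  -- endpoints and a representative, depending only on the trace on D
  have hpq0 : ∀ s : Set V, ∃ p q σ : V, ∀ x, x ∉ D → G.neighborSet x ∩ D = s →
      s = {p, q} ∧ (σ = x ∨ σ = tw x) := by
    intro s
    by_cases h : ∃ x, x ∉ D ∧ G.neighborSet x ∩ D = s
    · obtain ⟨x, hx, hs⟩ := h
      obtain ⟨a, -, b, -, -, h⟩ := hG.2.1 x hx
      refine ⟨a, b, x, fun z hz hzs => ⟨hs.symm.trans h, ?_⟩⟩
      exact (htw z hz).2.2.2 x hx (hs.trans hzs.symm)
    · by_cases hV : Nonempty V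
      · obtain ⟨v⟩ := hV
        exact ⟨v, v, v, fun x hx hs => (h ⟨x, hx, hs⟩).elim⟩
      · exfalso
        have : IsEmpty V := not_nonempty_iff.1 hV
        have : D = ∅ := Set.eq_empty_of_isEmpty D
        simp [this] at hlt
  choose p q σ hpq using hpq0
  have ht0 : ∀ x, ∃ t, x ∈ S \ D →
      (tw x ∈ S → t = if σ (G.neighborSet x ∩ D) = x then p (G.neighborSet x ∩ D)
        else q (G.neighborSet x ∩ D)) ∧
      (tw x ∉ S → ∀ r ∈ D \ S, G.Adj x r → r ≠ t → ∃ y ∈ S \ D, G.Adj y r ∧ G.Adj (tw x) y) := by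
    intro x
    by_cases hx : x ∈ S \ D
    swap
    · exact ⟨x, fun h => (hx h).elim⟩
    by_cases hxS : tw x ∈ S
    · exact ⟨_, fun _ => ⟨fun _ => rfl, fun h => (h hxS).elim⟩⟩
    obtain ⟨hD', hne, hn, -⟩ := htw x hx.2
    obtain ⟨y, hyS, hy⟩ := hS _ hxS
    obtain ⟨a, ha, b, hb, hab, h⟩ := hG.2.1 x hx.2
    have hmem : ∀ r ∈ D, G.Adj x r → r = a ∨ r = b := by
      intro r hr hxr
      have := (nbr_iff h r).2 ⟨hxr, hr⟩
      simpa using this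
    by_cases hyD : y ∈ D
    · -- y is an endpoint in S, the other endpoint is the tail
      have := (nbr_iff (hn.trans h) y).2 ⟨hy, hyD⟩
      rcases this with rfl | hyb
      · refine ⟨b, fun _ => ⟨fun h => (hxS h).elim, fun _ r hr hxr hrt => ?_⟩⟩
        rcases hmem r hr.1 hxr with rfl | rfl
        · exact (hr.2 hyS).elim
        · exact (hrt rfl).elim
      · obtain rfl : y = b := hyb
        refine ⟨a, fun _ => ⟨fun h => (hxS h).elim, fun _ r hr hxr hrt => ?_⟩⟩
        rcases hmem r hr.1 hxr with rfl | rfl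
        · exact (hrt rfl).elim
        · exact (hr.2 hyS).elim
    · -- no B, so a shared endpoint exists
      have : ∃ u ∈ D, G.Adj (tw x) u ∧ G.Adj y u := by
        by_contra hcon
        push Not at hcon
        exact hB (B_of_adj hG hD' hyD hy hcon)
      obtain ⟨u, hu, h1, h2⟩ := this
      have hu' := (nbr_iff (hn.trans h) u).2 ⟨h1, hu⟩
      rcases hu' with rfl | hub
      · refine ⟨b, fun _ => ⟨fun h => (hxS h).elim, fun _ r hr hxr hrt => ?_⟩⟩
        rcases hmem r hr.1 hxr with rfl | rfl
        · exact ⟨y, ⟨hyS, hyD⟩, h2, hy⟩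
        · exact (hrt rfl).elim
      · obtain rfl : u = b := hub
        refine ⟨a, fun _ => ⟨fun h => (hxS h).elim, fun _ r hr hxr hrt => ?_⟩⟩
        rcases hmem r hr.1 hxr with rfl | rfl
        · exact (hrt rfl).elim
        · exact ⟨y, ⟨hyS, hyD⟩, h2, hy⟩
  choose t ht using ht0
  have hcard : (t '' (S \ D)).ncard < (D \ S).ncard := by
    have h0 : (t '' (S \ D)).ncard ≤ (S \ D).ncard := Set.ncard_image_le (Set.toFinite _)
    have e1 := Set.ncard_inter_add_ncard_sdiff_eq_ncard D S
    have e2 := Set.ncard_inter_add_ncard_sdiff_eq_ncard S D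
    rw [Set.inter_comm] at e2
    omega
  obtain ⟨r, hr, hrt⟩ := Set.exists_mem_notMem_of_ncard_lt_ncard hcard
  have hrt' : ∀ x ∈ S \ D, r ≠ t x := fun x hx h => hrt ⟨x, hx, h.symm⟩
  obtain ⟨x0, hx0S, hx0⟩ := hS r hr.2
  refine A_of_cycle hG (S \ D) (fun x hx => hx.2) r hr.1 x0
    ⟨hx0S, fun h => hG.1 r hr.1 x0 h hx0⟩ hx0.symm tw htw ?_
  intro x hx hxr
  obtain ⟨hD', hne, hn, hall⟩ := htw x hx.2
  have hnot : tw x ∉ S := by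
    intro hxS
    have e1 := (ht x hx).1 hxS
    have htt : tw (tw x) = x := by
      rcases (htw _ hD').2.2.2 x hx.2 hn.symm with h | h
      · exact (hne h.symm).elim
      · exact h.symm
    have e2 := (ht (tw x) ⟨hxS, hD'⟩).1 (htt.symm ▸ hx.1)
    rw [hn] at e2
    obtain ⟨hs, hσ⟩ := hpq _ x hx.2 rfl
    have hmem := (nbr_iff hs r).2 ⟨hxr, hr.1⟩
    have n1 := hrt' x hx
    have n2 := hrt' _ ⟨hxS, hD'⟩
    simp only [Set.mem_insert_iff, Set.mem_singleton_iff] at hmem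
    rcases hσ with h | h
    · rw [h, if_pos rfl] at e1
      rw [h, if_neg hne.symm] at e2
      rcases hmem with h | h
      · exact n1 (h.trans e1.symm)
      · exact n2 (h.trans e2.symm)
    · rw [h, if_neg hne] at e1
      rw [h, if_pos rfl] at e2
      rcases hmem with h | h
      · exact n2 (h.trans e2.symm)
      · exact n1 (h.trans e1.symm)
  exact ⟨fun h => hnot h.1, (ht x hx).2 hnot r hr hxr (hrt' x hx)⟩

end StmtAux

/-- Characterization: for `G ∈ 𝒢₂(F)` with `(C₃,C₄)`-free underlying graph,
`γ(G) = γ₂(G)` iff `G^D` contains no subgraph isomorphic to `B^W` and no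
subgraph isomorphic to `A_k^W` for any `k ≥ 2`. -/
theorem stmt_8 {V : Type*} [Fintype V] (G : SimpleGraph V) (D : Set V)
    (hG : memG2 G D) (hF : underNoC3C4 G D) :
    kDomNum G 1 = kDomNum G 2 ↔
      ¬ containsDSub Bgraph BW G D ∧
      ∀ k : ℕ, 2 ≤ k → ¬ containsDSub (Agraph k) (AW k) G D := by
  rw [StmtAux.gamma_eq_iff hG]
  constructor
  · intro h
    exact ⟨fun hB => h (StmtAux.of_B hG hF hB), fun k hk hA => h (StmtAux.of_A hG hF k hk hA)⟩
  · rintro ⟨hB, hA⟩ ⟨S, hS, hlt⟩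
    obtain ⟨k, hk, h⟩ := StmtAux.converse hG hB S hS hlt
    exact hA k hk h
end

section
/- Let F be a finite simple graph containing no cycle of length 3 or 4, and let G ∈ 𝒢₂(F) with specified set D = V(F). If G^D contains a subgraph isomorphic to B^W, then γ(G) < γ₂(G). -/
theorem aux_pos {V : Type*} [Fintype V] (G : SimpleGraph V) (S : Set V) (z s : V)
    (hs : s ∈ S) (h : G.Adj z s) : 1 ≤ (S ∩ G.neighborSet z).ncard :=
  (Set.ncard_pos (Set.toFinite _)).2 ⟨s, hs, h⟩

theorem aux_pair {V : Type*} {A : Set V} {p q a b : V} (h : A = {p, q}) (ha : a ∈ A) (hb : b ∈ A)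
    (hab : a ≠ b) : A = {a, b} := by
  subst h
  ext t
  simp only [Set.mem_insert_iff, Set.mem_singleton_iff] at *
  grind

theorem aux_nbr {V : Type*} (G : SimpleGraph V) (D : Set V) (hG : memG2 G D) {x a b : V}
    (hx : x ∉ D) (ha : a ∈ D) (hb : b ∈ D) (hab : a ≠ b) (h1 : G.Adj x a) (h2 : G.Adj x b) :
    G.neighborSet x ∩ D = {a, b} := by
  obtain ⟨p, _, q, _, _, h⟩ := hG.2.1 x hx
  exact aux_pair h ⟨h1, ha⟩ ⟨h2, hb⟩ hab

theorem aux_symm {V : Type*} {G : SimpleGraph V} {D : Set V} {a b : V}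
    (h : underAdj G D a b) : underAdj G D b a := by
  obtain ⟨h1, h2, h3, x, h4, h5⟩ := h
  exact ⟨h2, h1, h3.symm, x, h4, by rw [h5, Set.pair_comm]⟩

theorem aux_lower {V : Type*} [Fintype V] (G : SimpleGraph V) (D : Set V)
    (hG : memG2 G D) (S : Set V) (hS : kDomSet G 2 S) : D.ncard ≤ S.ncard := by
  classical
  have key : (D \ S).toFinset.card * 2 ≤ (S \ D).toFinset.card * 2 := by
    apply Finset.card_mul_le_card_mul G.Adj
    · intro v hv
      simp only [Set.mem_toFinset, Set.mem_diff] at hv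
      refine (hS v hv.2).trans ?_
      rw [← Set.ncard_coe_finset]
      apply Set.ncard_le_ncard _ (Set.toFinite _)
      rintro t ⟨h1, h2⟩
      simp only [Finset.coe_bipartiteAbove, Set.mem_toFinset, Set.mem_setOf_eq, Set.mem_diff]
      exact ⟨⟨h1, fun h => hG.1 v hv.1 t h h2⟩, h2⟩
    · intro x hx
      simp only [Set.mem_toFinset, Set.mem_diff] at hx
      obtain ⟨p, _, q, _, _, h⟩ := hG.2.1 x hx.2
      refine le_trans ?_ (Finset.card_le_two (a := p) (b := q))
      apply Finset.card_le_card
      intro t ht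
      simp only [Finset.mem_bipartiteBelow, Set.mem_toFinset, Set.mem_diff] at ht
      have : t ∈ G.neighborSet x ∩ D := ⟨ht.2.symm, ht.1.1⟩
      rw [h] at this
      simpa using this
  rw [← Set.ncard_eq_toFinset_card', ← Set.ncard_eq_toFinset_card'] at key
  have h1 := Set.ncard_inter_add_ncard_diff_eq_ncard D S (Set.toFinite _)
  have h2 := Set.ncard_inter_add_ncard_diff_eq_ncard S D (Set.toFinite _)
  rw [Set.inter_comm] at h2
  omega

theorem aux_upper {V : Type*} [Fintype V] (G : SimpleGraph V) (D : Set V)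
    (hG : memG2 G D) {v u w a x y : V} (hv : v ∈ D) (hu : u ∈ D) (hw : w ∈ D)
    (hvu : v ≠ u) (hvw : v ≠ w) (huw : u ≠ w) (ha : a ∉ D) (hx : x ∉ D) (hax : a ≠ x)
    (hav : G.Adj v a) (hau : G.Adj u a) (hxv : G.Adj v x) (hxu : G.Adj u x)
    (hya : G.Adj a y) (hyw : G.Adj w y)
    (n1 : ¬ underAdj G D w v) (n2 : ¬ underAdj G D w u) :
    ∃ S, kDomSet G 1 S ∧ S.ncard < D.ncard := by
  refine ⟨(D \ {v, u, w}) ∪ {x, y}, ?_, ?_⟩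
  · intro z hz
    simp only [Set.mem_union, Set.mem_diff, Set.mem_insert_iff, Set.mem_singleton_iff,
      not_or, not_and, not_not] at hz
    obtain ⟨hz1, hzx, hzy⟩ := hz
    by_cases hzD : z ∈ D
    · rcases (by tauto : z = v ∨ z = u ∨ z = w) with rfl | rfl | rfl
      · exact aux_pos G _ _ x (by simp) hxv
      · exact aux_pos G _ _ x (by simp) hxu
      · exact aux_pos G _ _ y (by simp) hyw
    · obtain ⟨p, hp, q, hq, hpq, h⟩ := hG.2.1 z hzD
      have hzp : G.Adj z p := (h.symm ▸ (by simp) : p ∈ G.neighborSet z ∩ D).1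
      have hzq : G.Adj z q := (h.symm ▸ (by simp) : q ∈ G.neighborSet z ∩ D).1
      by_cases hp' : p = v ∨ p = u ∨ p = w
      swap
      · exact aux_pos G _ _ p (Or.inl ⟨hp, by simpa using hp'⟩) hzp
      by_cases hq' : q = v ∨ q = u ∨ q = w
      swap
      · exact aux_pos G _ _ q (Or.inl ⟨hq, by simpa using hq'⟩) hzq
      have hU : underAdj G D p q := ⟨hp, hq, hpq, z, hzD, h⟩
      have hU' := aux_symm hU
      have hz2 : G.neighborSet z ∩ D = {v, u} := by
        rw [h]
        rcases hp' with rfl | rfl | rfl <;> rcases hq' with rfl | rfl | rfl <;>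
          first | rfl | exact Set.pair_comm _ _ | (exfalso; tauto)
      have hsub : ({a, x} : Set V) ⊆ {x | x ∉ D ∧ G.neighborSet x ∩ D = {v, u}} := by
        rintro t (rfl | rfl)
        · exact ⟨ha, aux_nbr G D hG ha hv hu hvu hav.symm hau.symm⟩
        · exact ⟨hx, aux_nbr G D hG hx hv hu hvu hxv.symm hxu.symm⟩
      have h2 := Set.ncard_le_ncard hsub (Set.toFinite _)
      rw [Set.ncard_pair hax] at h2
      have heq := Set.eq_of_subset_of_ncard_le hsub
        (by rw [Set.ncard_pair hax]; rcases hG.2.2.1 v hv u hu hvu with h | h <;> omega)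
        (Set.toFinite _)
      have : z ∈ ({a, x} : Set V) := by rw [heq]; exact ⟨hzD, hz2⟩
      rcases this with rfl | h
      · exact aux_pos G _ _ y (by simp) hya
      · exact absurd h hzx
  · have h3 : ({v, u, w} : Set V).ncard = 3 := Set.ncard_eq_three.2 ⟨v, u, w, hvu, hvw, huw, rfl⟩
    have hs : ({v, u, w} : Set V) ⊆ D := by rintro t (rfl | rfl | rfl) <;> assumption
    have e1 := Set.ncard_diff_add_ncard_of_subset hs (Set.toFinite _)
    have e2 := Set.ncard_union_le (D \ {v, u, w}) {x, y}
    have e3 : ({x, y} : Set V).ncard ≤ 2 := by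
      have := Set.ncard_insert_le x {y}
      rwa [Set.ncard_singleton] at this
    omega

/-- If `G ∈ 𝒢₂(F)` with `(C₃,C₄)`-free underlying graph `F` and `G^D` contains a
subgraph isomorphic to `B^W`, then `γ(G) < γ₂(G)`. -/
theorem stmt_9 {V : Type*} [Fintype V] (G : SimpleGraph V) (D : Set V)
    (hG : memG2 G D) (hF : underNoC3C4 G D)
    (hB : containsDSub Bgraph BW G D) :
    kDomNum G 1 < kDomNum G 2 := by
  classical
  suffices hS : ∃ S, kDomSet G 1 S ∧ S.ncard < D.ncard by
    obtain ⟨S, hS, hlt⟩ := hS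
    have l1 : kDomNum G 1 ≤ S.ncard := Nat.sInf_le ⟨S, hS, rfl⟩
    have hne : {n | ∃ D : Set V, kDomSet G 2 D ∧ D.ncard = n}.Nonempty :=
      ⟨_, Set.univ, fun v hv => absurd (Set.mem_univ v) hv, rfl⟩
    obtain ⟨T, hT, hTe⟩ := Nat.sInf_mem hne
    have l2 := aux_lower G D hG T hT
    have l3 : kDomNum G 2 = T.ncard := hTe.symm
    omega
  obtain ⟨φ, hinj, hadj, hD⟩ := hB
  have hDin : ∀ i, φ (Sum.inl i) ∈ D := fun i => (hD _).2 ⟨i, rfl⟩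
  have hDout : ∀ i, φ (Sum.inr i) ∉ D := fun i h => by
    obtain ⟨j, hj⟩ := (hD _).1 h
    cases hj
  have hA : ∀ i b c, G.Adj (φ (Sum.inl (i, b))) (φ (Sum.inr (i, c))) := fun i b c =>
    hadj _ _ (by simp [Bgraph])
  have hXX : G.Adj (φ (Sum.inr (0, false))) (φ (Sum.inr (1, false))) :=
    hadj _ _ (by simp [Bgraph])
  have hne : ∀ i j, i ≠ j → φ (Sum.inl i) ≠ φ (Sum.inl j) := fun i j h h' =>
    h (Sum.inl_injective (hinj h'))
  have hax : φ (Sum.inr (0, false)) ≠ φ (Sum.inr (0, true)) := fun h => by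
    simpa using hinj h
  have d1 := hne (0, false) (0, true) (by simp)
  have d2 := hne (0, false) (1, false) (by simp)
  have d3 := hne (0, false) (1, true) (by simp)
  have d4 := hne (0, true) (1, false) (by simp)
  have d5 := hne (0, true) (1, true) (by simp)
  have d6 := hne (1, false) (1, true) (by simp)
  have U : ∀ i, underAdj G D (φ (Sum.inl (i, false))) (φ (Sum.inl (i, true))) := fun i =>
    ⟨hDin _, hDin _, hne _ _ (by simp), φ (Sum.inr (i, false)), hDout _,
      aux_nbr G D hG (hDout _) (hDin _) (hDin _) (hne _ _ (by simp)) (hA _ _ _).symm (hA _ _ _).symm⟩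
  have main : ∀ b, ¬ underAdj G D (φ (Sum.inl (1, b))) (φ (Sum.inl (0, false))) →
      ¬ underAdj G D (φ (Sum.inl (1, b))) (φ (Sum.inl (0, true))) →
      ∃ S, kDomSet G 1 S ∧ S.ncard < D.ncard := fun b n1 n2 =>
    aux_upper G D hG (hDin (0, false)) (hDin (0, true)) (hDin (1, b)) d1
      (hne _ _ (by simp)) (hne _ _ (by simp)) (hDout (0, false)) (hDout (0, true)) hax
      (hA _ _ _) (hA _ _ _) (hA _ _ _) (hA _ _ _) hXX (hA 1 b false) n1 n2
  by_contra hcon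
  have m1 := fun n1 n2 => hcon (main false n1 n2)
  have m2 := fun n1 n2 => hcon (main true n1 n2)
  have U0 := U 0
  have U1 := U 1
  generalize φ (Sum.inl (0, false)) = v1 at *
  generalize φ (Sum.inl (0, true)) = u1 at *
  generalize φ (Sum.inl (1, false)) = v2 at *
  generalize φ (Sum.inl (1, true)) = u2 at *
  obtain ⟨f3, f4⟩ := hF
  have h1 : underAdj G D v2 v1 ∨ underAdj G D v2 u1 := by tauto
  have h2 : underAdj G D u2 v1 ∨ underAdj G D u2 u1 := by tauto
  rcases h1 with h1 | h1 <;> rcases h2 with h2 | h2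
  · exact f3 ⟨v2, u2, v1, U1, h2, h1⟩
  · exact f4 ⟨v2, v1, u1, u2, d2.symm, d4.symm, d6, d1, d3, d5, h1, U0, aux_symm h2, aux_symm U1⟩
  · exact f4 ⟨v2, u1, v1, u2, d4.symm, d2.symm, d6, d1.symm, d5, d3, h1, aux_symm U0, aux_symm h2,
      aux_symm U1⟩
  · exact f3 ⟨v2, u2, u1, U1, h2, h1⟩
end

section
/- Let F be a finite simple graph containing no cycle of length 3 or 4, and let G ∈ 𝒢₂(F) with specified set D = V(F). If G^D contains a subgraph isomorphic to A_k^W for some integer k ≥ 2, then γ(G) < γ₂(G). -/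
lemma g2_lower {V : Type*} [Fintype V] (G : SimpleGraph V) (D : Set V)
    (hG : memG2 G D) (T : Set V) (hT : kDomSet G 2 T) : D.ncard ≤ T.ncard := by
  classical
  obtain ⟨h1, h2, h3, h4⟩ := hG
  have key : (D \ T).toFinset.card * 2 ≤ (T \ D).toFinset.card * 2 := by
    apply Finset.card_mul_le_card_mul (fun a b => G.Adj a b)
    · intro a ha
      simp only [Set.mem_toFinset, Set.mem_diff] at ha
      refine (hT a ha.2).trans ?_
      rw [← Set.ncard_coe_finset]
      apply Set.ncard_le_ncard _ (Set.toFinite _)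
      intro y hy
      simp only [Finset.coe_bipartiteAbove, Set.mem_toFinset, Set.mem_setOf_eq, Set.mem_diff]
      exact ⟨⟨hy.1, fun hyD => h1 a ha.1 y hyD hy.2⟩, hy.2⟩
    · intro b hb
      simp only [Set.mem_toFinset, Set.mem_diff] at hb
      obtain ⟨u, hu, w, hw, huw, hN⟩ := h2 b hb.2
      rw [← Set.ncard_pair huw, ← hN, ← Set.ncard_coe_finset]
      apply Set.ncard_le_ncard _ (Set.toFinite _)
      intro y hy
      simp only [Finset.coe_bipartiteBelow, Set.mem_toFinset, Set.mem_setOf_eq, Set.mem_diff] at hy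
      exact ⟨hy.2.symm, hy.1.1⟩
  rw [← Set.ncard_eq_toFinset_card', ← Set.ncard_eq_toFinset_card'] at key
  have e1 := Set.ncard_inter_add_ncard_diff_eq_ncard D T (Set.toFinite _)
  have e2 := Set.ncard_inter_add_ncard_diff_eq_ncard T D (Set.toFinite _)
  rw [Set.inter_comm] at e2
  omega

lemma g2_nbhd {V : Type*} (G : SimpleGraph V) (D : Set V)
    (hG : memG2 G D) {x u w : V} (hx : x ∉ D) (hu : u ∈ D) (hw : w ∈ D) (huw : u ≠ w)
    (hxu : G.Adj x u) (hxw : G.Adj x w) : G.neighborSet x ∩ D = {u, w} := by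
  obtain ⟨a, ha, b, hb, hab, hN⟩ := hG.2.1 x hx
  have h1 : u ∈ G.neighborSet x ∩ D := ⟨hxu, hu⟩
  have h2 : w ∈ G.neighborSet x ∩ D := ⟨hxw, hw⟩
  rw [hN] at h1 h2 ⊢
  simp only [Set.mem_insert_iff, Set.mem_singleton_iff] at h1 h2
  rcases h1 with rfl | rfl <;> rcases h2 with rfl | rfl
  · exact absurd rfl huw
  · rfl
  · exact Set.pair_comm _ _
  · exact absurd rfl huw

lemma g2_upper {V : Type*} [Fintype V] (G : SimpleGraph V) (D : Set V)
    (hG : memG2 G D) (hF : underNoC3C4 G D)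
    (k : ℕ) (hk : 2 ≤ k) (hA : containsDSub (Agraph k) (AW k) G D) :
    ∃ S : Set V, kDomSet G 1 S ∧ S.ncard < D.ncard := by
  classical
  obtain ⟨φ, inj, hadj, hD⟩ := hA
  have hl : ∀ a, φ (Sum.inl a) ∈ D := fun a => (hD _).2 ⟨a, rfl⟩
  have hr : ∀ a, φ (Sum.inr a) ∉ D := fun a h => by
    obtain ⟨b, hb⟩ := (hD _).1 h
    simp at hb
  have av : ∀ p, G.Adj (φ (Sum.inr p)) (φ (Sum.inl none)) := fun p =>
    hadj _ _ (by simp [Agraph])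
  have aw : ∀ i b, G.Adj (φ (Sum.inr (i, b))) (φ (Sum.inl (some i))) := fun i b =>
    hadj _ _ (by simp [Agraph])
  have ax : ∀ i j : Fin k, (j : ℕ) = ((i : ℕ) + 1) % k →
      G.Adj (φ (Sum.inr (j, true))) (φ (Sum.inr (i, false))) := fun i j h =>
    hadj _ _ (by simp [Agraph, h])
  have nb : ∀ i b, G.neighborSet (φ (Sum.inr (i, b))) ∩ D =
      {φ (Sum.inl none), φ (Sum.inl (some i))} := fun i b =>
    g2_nbhd G D hG (hr _) (hl _) (hl _) (fun h => by simpa using inj h) (av _) (aw _ _)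
  set f : Fin k → V := fun i => φ (Sum.inr (i, false)) with hf
  set P : Set V := Set.range (fun a : Option (Fin k) => φ (Sum.inl a)) with hP
  have fin1 : ∀ (S : Set V) x y, y ∈ S → G.Adj x y → 1 ≤ (S ∩ G.neighborSet x).ncard := by
    intro S x y hy h
    exact (Set.ncard_pos (Set.toFinite _)).2 ⟨y, hy, h⟩
  have only : ∀ i x, x ∉ D → G.neighborSet x ∩ D = {φ (Sum.inl none), φ (Sum.inl (some i))} →
      ∃ b, x = φ (Sum.inr (i, b)) := by
    intro i x hx hN
    by_contra! hne
    have hle : {x | x ∉ D ∧ G.neighborSet x ∩ D =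
        {φ (Sum.inl none), φ (Sum.inl (some i))}}.ncard ≤ 2 := by
      rcases hG.2.2.1 _ (hl none) _ (hl (some i)) (fun h => by simpa using inj h) with h | h <;>
        omega
    have h3 : ({x, φ (Sum.inr (i, false)), φ (Sum.inr (i, true))} : Set V).ncard = 3 :=
      Set.ncard_eq_three.2 ⟨_, _, _, hne _, hne _, fun h => by simpa using inj h, rfl⟩
    have hsub : ({x, φ (Sum.inr (i, false)), φ (Sum.inr (i, true))} : Set V) ⊆
        {x | x ∉ D ∧ G.neighborSet x ∩ D = {φ (Sum.inl none), φ (Sum.inl (some i))}} := by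
      rintro y (rfl | rfl | rfl)
      · exact ⟨hx, hN⟩
      · exact ⟨hr _, nb _ _⟩
      · exact ⟨hr _, nb _ _⟩
    have := Set.ncard_le_ncard hsub (Set.toFinite _)
    omega
  refine ⟨(D \ P) ∪ Set.range f, ?_, ?_⟩
  · intro x hx
    have hmem : ∀ i, f i ∈ (D \ P) ∪ Set.range f := fun i => Or.inr ⟨i, rfl⟩
    have case1 : ∀ i, x ∉ D → G.neighborSet x ∩ D =
        {φ (Sum.inl none), φ (Sum.inl (some i))} →
        1 ≤ (((D \ P) ∪ Set.range f) ∩ G.neighborSet x).ncard := by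
      intro i hxD hN
      obtain ⟨b, rfl⟩ := only i x hxD hN
      cases b with
      | false => exact absurd (hmem i) hx
      | true =>
        have hi := i.2
        refine fin1 _ _ _ (hmem ⟨(i + (k - 1)) % k, Nat.mod_lt _ (by omega)⟩) (ax _ _ ?_)
        simp only [Nat.mod_add_mod]
        rw [show (i : ℕ) + (k - 1) + 1 = i + k by omega, Nat.add_mod_right, Nat.mod_eq_of_lt hi]
    by_cases hxD : x ∈ D
    · have hxP : x ∈ P := by
        by_contra h
        exact hx (Or.inl ⟨hxD, h⟩)
      obtain ⟨a, rfl⟩ := hxP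
      cases a with
      | none => exact fin1 _ _ _ (hmem ⟨0, by omega⟩) (av _).symm
      | some i => exact fin1 _ _ _ (hmem i) (aw _ _).symm
    · obtain ⟨u, hu, w, hw, huw, hN⟩ := hG.2.1 x hxD
      have hxu : u ∈ G.neighborSet x ∩ D := by rw [hN]; simp
      have hxw : w ∈ G.neighborSet x ∩ D := by rw [hN]; simp
      by_cases huP : u ∈ P
      swap
      · exact fin1 _ _ u (Or.inl ⟨hu, huP⟩) hxu.1
      by_cases hwP : w ∈ P
      swap
      · exact fin1 _ _ w (Or.inl ⟨hw, hwP⟩) hxw.1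
      obtain ⟨a, rfl⟩ := huP
      obtain ⟨b, rfl⟩ := hwP
      rcases a with _ | i <;> rcases b with _ | j
      · exact absurd rfl huw
      · exact case1 j hxD hN
      · exact case1 i hxD (hN.trans (Set.pair_comm _ _))
      · exfalso
        have hu : ∀ i, underAdj G D (φ (Sum.inl none)) (φ (Sum.inl (some i))) := fun i =>
          ⟨hl _, hl _, fun h => by simpa using inj h, _, hr (i, false), nb _ _⟩
        exact hF.1 ⟨_, _, _, hu i, ⟨hl _, hl _, huw, x, hxD, hN⟩, hu j⟩
  · have hPD : P ⊆ D := by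
      rintro _ ⟨a, rfl⟩
      exact hl a
    have cP : P.ncard = k + 1 := by
      rw [hP, ← Set.image_univ, Set.ncard_image_of_injective _
        (fun a b h => Sum.inl_injective (inj h)), Set.ncard_univ]
      simp
    have cf : (Set.range f).ncard ≤ k := by
      rw [← Set.image_univ]
      refine (Set.ncard_image_le (Set.toFinite _)).trans ?_
      rw [Set.ncard_univ]; simp
    have h1 := Set.ncard_union_le (D \ P) (Set.range f)
    have h2 := Set.ncard_diff_add_ncard_of_subset hPD (Set.toFinite _)
    omega

/-- If `G ∈ 𝒢₂(F)` with `(C₃,C₄)`-free underlying graph `F` and `G^D` contains a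
subgraph isomorphic to `A_k^W` for some `k ≥ 2`, then `γ(G) < γ₂(G)`. -/
theorem stmt_10 {V : Type*} [Fintype V] (G : SimpleGraph V) (D : Set V)
    (hG : memG2 G D) (hF : underNoC3C4 G D)
    (k : ℕ) (hk : 2 ≤ k) (hA : containsDSub (Agraph k) (AW k) G D) :
    kDomNum G 1 < kDomNum G 2 := by
  obtain ⟨S, hS, hlt⟩ := g2_upper G D hG hF k hk hA
  have hne : {n | ∃ T : Set V, kDomSet G 2 T ∧ T.ncard = n}.Nonempty :=
    ⟨_, Set.univ, fun v hv => absurd (Set.mem_univ v) hv, rfl⟩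
  obtain ⟨T, hT, hc⟩ := Nat.sInf_mem hne
  have h1 : kDomNum G 1 ≤ S.ncard := Nat.sInf_le ⟨S, hS, rfl⟩
  have h2 := g2_lower G D hG T hT
  have h3 : T.ncard = kDomNum G 2 := hc
  omega
end

section
/- For every k ≥ 1 and integers i₁,…,i_k ≥ 2, the graph G = S(i₁,…,i_k) satisfies γ(G) = γ₂(G) = k + 1. -/
/-- Vertex type of `S(i₁,…,i_k)` (with `i_j = f j`): `Sum.inl none = v`,
`Sum.inl (some j) = v_j`, `Sum.inr ⟨j, r⟩ = x_j^r`. -/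
abbrev SV (k : ℕ) (f : Fin k → ℕ) := Option (Fin k) ⊕ (Σ j : Fin k, Fin (f j))

/-- The graph `S(i₁,…,i_k)`: edges are exactly `v x_j^r` and `v_j x_j^r`. -/
def Sgraph (k : ℕ) (f : Fin k → ℕ) : SimpleGraph (SV k f) :=
  SimpleGraph.fromRel (fun a b =>
    match a, b with
    | Sum.inl none, Sum.inr _ => True
    | Sum.inl (some j), Sum.inr x => j = x.1
    | _, _ => False)

/-- The class `𝒮`: graphs isomorphic to some `S(i₁,…,i_k)` with `k ≥ 1` and all `i_j ≥ 2`. -/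
def inS {V : Type*} (G : SimpleGraph V) : Prop :=
  ∃ (k : ℕ) (f : Fin k → ℕ), 1 ≤ k ∧ (∀ j, 2 ≤ f j) ∧ Nonempty (G ≃g Sgraph k f)

lemma Sgraph_adj_none {k : ℕ} {f : Fin k → ℕ} {u : SV k f}
    (h : (Sgraph k f).Adj (Sum.inl none) u) : ∃ x, u = Sum.inr x := by
  rcases u with (_ | j) | x <;> simp [Sgraph] at h ⊢

lemma Sgraph_adj_some {k : ℕ} {f : Fin k → ℕ} {j : Fin k} {u : SV k f}
    (h : (Sgraph k f).Adj (Sum.inl (some j)) u) : ∃ r, u = Sum.inr ⟨j, r⟩ := by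
  rcases u with (_ | j') | ⟨j', r⟩
  · simp [Sgraph] at h
  · simp [Sgraph] at h
  · simp [Sgraph] at h
    subst h
    exact ⟨r, rfl⟩

lemma Sgraph_adj_inr {k : ℕ} {f : Fin k → ℕ} {x : Σ j : Fin k, Fin (f j)} {u : SV k f}
    (h : (Sgraph k f).Adj (Sum.inr x) u) : u = Sum.inl none ∨ u = Sum.inl (some x.1) := by
  rcases u with (_ | j') | y <;> simp [Sgraph] at h ⊢
  exact h

def SVb {k : ℕ} {f : Fin k → ℕ} : SV k f → Option (Fin k)
  | Sum.inl o => o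
  | Sum.inr x => some x.1

lemma Sgraph_lower (k : ℕ) (f : Fin k → ℕ) (hf : ∀ j, 2 ≤ f j) (D : Set (SV k f))
    (hD : ∀ v ∉ D, ∃ u ∈ D, (Sgraph k f).Adj v u) : k + 1 ≤ D.ncard := by
  have h1 : ∀ j : Fin k, ∃ u ∈ D, SVb u = some j := by
    intro j
    by_cases h : Sum.inl (some j) ∈ D
    · exact ⟨_, h, rfl⟩
    · obtain ⟨u, hu, ha⟩ := hD _ h
      obtain ⟨r, rfl⟩ := Sgraph_adj_some ha
      exact ⟨_, hu, rfl⟩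
  choose g hg hgb using h1
  have h2 : ∃ w ∈ D, ∀ j, g j ≠ w := by
    by_contra hc
    push Not at hc
    have key : ∀ w ∈ D, ∀ j, SVb w = some j → w = g j := by
      intro w hw j hj
      obtain ⟨i, rfl⟩ := hc w hw
      rw [hgb] at hj
      cases hj
      rfl
    have hn : (Sum.inl none : SV k f) ∉ D := by
      intro h
      obtain ⟨i, hi⟩ := hc _ h
      have := hgb i
      rw [hi] at this
      simp [SVb] at this
    obtain ⟨u, hu, ha⟩ := hD _ hn
    obtain ⟨⟨j, r⟩, rfl⟩ := Sgraph_adj_none ha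
    have e1 := key _ hu j rfl
    have : Nontrivial (Fin (f j)) := Fin.nontrivial_iff_two_le.2 (hf j)
    obtain ⟨s, hs⟩ := exists_ne r
    have hsD : (Sum.inr ⟨j, s⟩ : SV k f) ∉ D := by
      intro h
      have e2 := (key _ h j rfl).trans e1.symm
      simp at e2
      exact hs e2
    obtain ⟨u, hu', ha⟩ := hD _ hsD
    rcases Sgraph_adj_inr ha with rfl | rfl
    · exact hn hu'
    · have e2 := (key _ hu' j rfl).trans e1.symm
      simp at e2
  obtain ⟨w, hw, hwg⟩ := h2
  have gi : Function.Injective g := by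
    intro a b hab
    have := hgb a
    rw [hab, hgb] at this
    exact (Option.some.inj this).symm
  have hsub : insert w (Set.range g) ⊆ D := by
    rintro x (rfl | ⟨j, rfl⟩)
    · exact hw
    · exact hg j
  have hcard : (insert w (Set.range g)).ncard = k + 1 := by
    rw [Set.ncard_insert_of_notMem (by rintro ⟨j, hj⟩; exact hwg j hj) (Set.toFinite _)]
    rw [← Set.image_univ, Set.ncard_image_of_injective _ gi]
    simp
  rw [← hcard]
  exact Set.ncard_le_ncard hsub (Set.toFinite _)

lemma Sgraph_upper (k : ℕ) (f : Fin k → ℕ) :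
    kDomSet (Sgraph k f) 2 (Set.range Sum.inl) := by
  rintro (o | ⟨j, r⟩) hv
  · exact absurd ⟨o, rfl⟩ hv
  · have : ({Sum.inl none, Sum.inl (some j)} : Set (SV k f)).ncard = 2 :=
      Set.ncard_pair (by simp)
    rw [← this]
    apply Set.ncard_le_ncard _ (Set.toFinite _)
    rintro x (rfl | rfl)
    · exact ⟨⟨_, rfl⟩, by simp [Sgraph]⟩
    · exact ⟨⟨_, rfl⟩, by simp [Sgraph]⟩

lemma Sgraph_num (k : ℕ) (f : Fin k → ℕ) (hf : ∀ j, 2 ≤ f j) (m : ℕ) (h1 : 1 ≤ m)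
    (h2 : m ≤ 2) : kDomNum (Sgraph k f) m = k + 1 := by
  have hmem : k + 1 ∈ {n | ∃ D : Set (SV k f), kDomSet (Sgraph k f) m D ∧ D.ncard = n} := by
    refine ⟨Set.range Sum.inl, fun v hv => h2.trans (Sgraph_upper k f v hv), ?_⟩
    rw [← Set.image_univ, Set.ncard_image_of_injective _ Sum.inl_injective]
    simp [Set.ncard_univ]
  apply le_antisymm
  · exact Nat.sInf_le hmem
  · apply le_csInf ⟨_, hmem⟩
    rintro n ⟨D, hD, rfl⟩
    apply Sgraph_lower k f hf
    intro v hv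
    have h3 := h1.trans (hD v hv)
    obtain ⟨u, hu⟩ := Set.nonempty_of_ncard_ne_zero (by omega : (D ∩ (Sgraph k f).neighborSet v).ncard ≠ 0)
    exact ⟨u, hu.1, hu.2⟩

/-- For `k ≥ 1` and all `i_j ≥ 2`, the graph `S(i₁,…,i_k)` satisfies
`γ = γ₂ = k + 1`. -/
theorem stmt_12 (k : ℕ) (hk : 1 ≤ k) (f : Fin k → ℕ) (hf : ∀ j, 2 ≤ f j) :
    kDomNum (Sgraph k f) 1 = k + 1 ∧ kDomNum (Sgraph k f) 2 = k + 1 := by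
  exact ⟨Sgraph_num k f hf 1 (by norm_num) (by norm_num), Sgraph_num k f hf 2 (by norm_num) (by norm_num)⟩
end

section
/- A connected finite simple graph G with minimum degree δ(G) ≥ 2 is (γ,γ₂)-perfect if and only if G belongs to the class 𝒮, i.e., G is isomorphic to S(i₁,…,i_k) for some k ≥ 1 and i₁,…,i_k ≥ 2. -/
/-- relative domination -/
def RD1 {V : Type*} (G : SimpleGraph V) (s A : Finset V) : Prop :=
  A ⊆ s ∧ ∀ v ∈ s, v ∉ A → ∃ a ∈ A, G.Adj v a

/-- relative 2-domination -/
def RD2 {V : Type*} (G : SimpleGraph V) (s A : Finset V) : Prop :=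
  A ⊆ s ∧ ∀ v ∈ s, v ∉ A → ∃ a ∈ A, ∃ b ∈ A, a ≠ b ∧ G.Adj v a ∧ G.Adj v b

/-- relative min degree two -/
def RDeg {V : Type*} (G : SimpleGraph V) (s : Finset V) : Prop :=
  ∀ v ∈ s, ∃ a ∈ s, ∃ b ∈ s, a ≠ b ∧ G.Adj v a ∧ G.Adj v b

lemma kDomNum_mem {W : Type*} [Fintype W] (H : SimpleGraph W) (k : ℕ) :
    ∃ D : Set W, kDomSet H k D ∧ D.ncard = kDomNum H k :=
  Nat.sInf_mem (s := {n | ∃ D : Set W, kDomSet H k D ∧ D.ncard = n})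
    ⟨_, Set.univ, fun v hv => absurd (Set.mem_univ v) hv, rfl⟩

lemma kDomNum_le {W : Type*} [Fintype W] (H : SimpleGraph W) (k : ℕ) (D : Set W)
    (h : kDomSet H k D) : kDomNum H k ≤ D.ncard :=
  Nat.sInf_le ⟨D, h, rfl⟩

lemma kDomNum_mono {W : Type*} [Fintype W] (H : SimpleGraph W) :
    kDomNum H 1 ≤ kDomNum H 2 := by
  obtain ⟨D, hD, hc⟩ := kDomNum_mem H 2
  rw [← hc]
  exact kDomNum_le H 1 D (fun v hv => le_trans (by norm_num) (hD v hv))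

open Classical in
lemma toRD1 {V : Type*} [Fintype V] (G : SimpleGraph V) (s : Finset V)
    (D : Set (↑s : Set V)) (h : kDomSet (G.induce (↑s : Set V)) 1 D) :
    ∃ A, RD1 G s A ∧ A.card = D.ncard := by
  refine ⟨(Subtype.val '' D).toFinset, ⟨?_, ?_⟩, ?_⟩
  · intro v hv
    simp at hv
    exact hv.1
  · intro v hv hvA
    have hv' : (⟨v, hv⟩ : (↑s : Set V)) ∉ D := by
      intro hh; apply hvA; simp; exact ⟨hv, hh⟩
    have := h _ hv'
    obtain ⟨⟨a, ha⟩, haD, haN⟩ := (Set.ncard_pos (Set.toFinite _)).1 this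
    refine ⟨a, by simp; exact ⟨ha, haD⟩, by simpa using haN⟩
  · rw [← Set.ncard_eq_toFinset_card', Set.ncard_image_of_injective _ Subtype.val_injective]

open Classical in
lemma toRD2 {V : Type*} [Fintype V] (G : SimpleGraph V) (s : Finset V)
    (D : Set (↑s : Set V)) (h : kDomSet (G.induce (↑s : Set V)) 2 D) :
    ∃ A, RD2 G s A ∧ A.card = D.ncard := by
  refine ⟨(Subtype.val '' D).toFinset, ⟨?_, ?_⟩, ?_⟩
  · intro v hv
    simp at hv
    exact hv.1
  · intro v hv hvA
    have hv' : (⟨v, hv⟩ : (↑s : Set V)) ∉ D := by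
      intro hh; apply hvA; simp; exact ⟨hv, hh⟩
    have := h _ hv'
    obtain ⟨⟨a, ha⟩, ⟨b, hb⟩, ⟨haD, haN⟩, ⟨hbD, hbN⟩, hab⟩ :=
      (Set.one_lt_ncard_iff (Set.toFinite _)).1 this
    refine ⟨a, by simp; exact ⟨ha, haD⟩, b, by simp; exact ⟨hb, hbD⟩, by simpa using hab,
      by simpa using haN, by simpa using hbN⟩
  · rw [← Set.ncard_eq_toFinset_card', Set.ncard_image_of_injective _ Subtype.val_injective]

lemma card_pre {V : Type*} [Fintype V] (s A : Finset V) (h : A ⊆ s) :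
    ({x : (↑s : Set V) | x.1 ∈ A}).ncard = A.card := by
  rw [← Set.ncard_image_of_injective _ Subtype.val_injective, ← Set.ncard_coe_finset]
  congr 1
  ext v
  simp
  exact fun hv => h hv

lemma ofRD1 {V : Type*} [Fintype V] (G : SimpleGraph V) (s A : Finset V) (h : RD1 G s A) :
    kDomSet (G.induce (↑s : Set V)) 1 {x | x.1 ∈ A} := by
  intro v hv
  obtain ⟨a, ha, hadj⟩ := h.2 v.1 v.2 hv
  exact (Set.ncard_pos (Set.toFinite _)).2 ⟨⟨a, h.1 ha⟩, ha, by simpa using hadj⟩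

lemma ofRD2 {V : Type*} [Fintype V] (G : SimpleGraph V) (s A : Finset V) (h : RD2 G s A) :
    kDomSet (G.induce (↑s : Set V)) 2 {x | x.1 ∈ A} := by
  intro v hv
  obtain ⟨a, ha, b, hb, hab, hadj, hadj'⟩ := h.2 v.1 v.2 hv
  exact (Set.one_lt_ncard_iff (Set.toFinite _)).2 ⟨⟨a, h.1 ha⟩, ⟨b, h.1 hb⟩,
    ⟨ha, by simpa using hadj⟩, ⟨hb, by simpa using hadj'⟩, by simpa using hab⟩

lemma eq_iff_RD {V : Type*} [Fintype V] (G : SimpleGraph V) (s : Finset V) :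
    kDomNum (G.induce (↑s : Set V)) 1 = kDomNum (G.induce (↑s : Set V)) 2 ↔
    ∃ B, RD2 G s B ∧ ∀ A, RD1 G s A → B.card ≤ A.card := by
  constructor
  · intro h
    obtain ⟨D, hD, hc⟩ := kDomNum_mem (G.induce (↑s : Set V)) 2
    obtain ⟨B, hB, hBc⟩ := toRD2 G s D hD
    refine ⟨B, hB, fun A hA => ?_⟩
    rw [hBc, hc, ← h, ← card_pre s A hA.1]
    exact kDomNum_le _ _ _ (ofRD1 G s A hA)
  · rintro ⟨B, hB, hmin⟩
    apply le_antisymm (kDomNum_mono _)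
    obtain ⟨D, hD, hc⟩ := kDomNum_mem (G.induce (↑s : Set V)) 1
    obtain ⟨A, hA, hAc⟩ := toRD1 G s D hD
    rw [← hc, ← hAc]
    refine le_trans ?_ (hmin A hA)
    rw [← card_pre s B hB.1]
    exact kDomNum_le _ _ _ (ofRD2 G s B hB)

lemma deg_iff {V : Type*} [Fintype V] (G : SimpleGraph V) (s : Finset V) :
    (∀ x : (↑s : Set V), 2 ≤ ((G.induce (↑s : Set V)).neighborSet x).ncard) ↔ RDeg G s := by
  constructor
  · intro h v hv
    obtain ⟨⟨a, ha⟩, ⟨b, hb⟩, haN, hbN, hab⟩ :=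
      (Set.one_lt_ncard_iff (Set.toFinite _)).1 (h ⟨v, hv⟩)
    exact ⟨a, ha, b, hb, by simpa using hab, by simpa using haN, by simpa using hbN⟩
  · intro h v
    obtain ⟨a, ha, b, hb, hab, h1, h2⟩ := h v.1 v.2
    exact (Set.one_lt_ncard_iff (Set.toFinite _)).2 ⟨⟨a, ha⟩, ⟨b, hb⟩,
      by simpa using h1, by simpa using h2, by simpa using hab⟩

/-- perfect, in relative form -/
def Perf {V : Type*} (G : SimpleGraph V) : Prop :=
  ∀ s : Finset V, RDeg G s → ∃ B, RD2 G s B ∧ ∀ A, RD1 G s A → B.card ≤ A.card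

-- forward direction: forbidden configurations
open Classical in
lemma no_triangle {V : Type*} {G : SimpleGraph V} (hP : Perf G) {a b c : V}
    (hab : G.Adj a b) (hbc : G.Adj b c) (hac : G.Adj a c) : False := by
  obtain ⟨B, hB, hmin⟩ := hP {a, b, c} (by
    intro v hv
    have := hab.ne; have := hbc.ne; have := hac.ne
    simp only [Finset.mem_insert, Finset.mem_singleton] at hv
    rcases hv with rfl | rfl | rfl
    · exact ⟨b, by simp, c, by simp, hbc.ne, hab, hac⟩
    · exact ⟨a, by simp, c, by simp, hac.ne, hab.symm, hbc⟩
    · exact ⟨a, by simp, b, by simp, hab.ne, hac.symm, hbc.symm⟩)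
  have h1 := hmin {a} ⟨by simp, by
    intro v hv hva
    simp only [Finset.mem_insert, Finset.mem_singleton] at hv hva
    refine ⟨a, by simp, ?_⟩
    rcases hv with rfl | rfl | rfl
    · exact absurd rfl hva
    · exact hab.symm
    · exact hac.symm⟩
  simp at h1
  have key : ∃ v ∈ ({a, b, c} : Finset V), v ∉ B := by
    by_contra! hh
    have : ({a, b} : Finset V) ⊆ B := by
      intro v hv
      apply hh
      simp at hv ⊢; tauto
    have := Finset.card_le_card this
    rw [Finset.card_pair hab.ne] at this
    omega
  obtain ⟨v, hv, hvB⟩ := key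
  obtain ⟨p, hp, q, hq, hpq, -, -⟩ := hB.2 v hv hvB
  exact hpq (Finset.card_le_one.1 h1 p hp q hq)

/-- If `u, w` both have all their `s`-neighbours in `{x, y}`, then a 2-dominating set contains
`{u, w}` or `{x, y}`. -/
lemma pair_cases {V : Type*} {G : SimpleGraph V} {s B : Finset V} (hB : RD2 G s B)
    {u w x y : V} (hu : u ∈ s) (hw : w ∈ s)
    (hun : ∀ z ∈ s, G.Adj u z → z = x ∨ z = y) (hwn : ∀ z ∈ s, G.Adj w z → z = x ∨ z = y) :
    (u ∈ B ∧ w ∈ B) ∨ (x ∈ B ∧ y ∈ B) := by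
  have aux : ∀ u ∈ s, (∀ z ∈ s, G.Adj u z → z = x ∨ z = y) → u ∉ B → x ∈ B ∧ y ∈ B := by
    intro u hu hun huB
    obtain ⟨p, hp, q, hq, hpq, h1, h2⟩ := hB.2 u hu huB
    rcases hun p (hB.1 hp) h1 with rfl | rfl <;> rcases hun q (hB.1 hq) h2 with rfl | rfl <;>
      first | exact absurd rfl hpq | exact ⟨hp, hq⟩ | exact ⟨hq, hp⟩
  by_cases h1 : u ∈ B
  · by_cases h2 : w ∈ B
    · exact Or.inl ⟨h1, h2⟩
    · exact Or.inr (aux w hw hwn h2)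
  · exact Or.inr (aux u hu hun h1)

open Classical in
lemma four_le {V : Type*} {B : Finset V} {a b c d : V} (ha : a ∈ B) (hb : b ∈ B) (hc : c ∈ B)
    (hd : d ∈ B) (h1 : a ≠ b) (h2 : a ≠ c) (h3 : a ≠ d) (h4 : b ≠ c) (h5 : b ≠ d) (h6 : c ≠ d) :
    4 ≤ B.card := by
  have : ({a, b, c, d} : Finset V) ⊆ B := by
    intro v hv
    simp only [Finset.mem_insert, Finset.mem_singleton] at hv
    rcases hv with rfl | rfl | rfl | rfl <;> assumption
  have h := Finset.card_le_card this
  have h4 : ({a, b, c, d} : Finset V).card = 4 := by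
    rw [Finset.card_insert_of_notMem, Finset.card_insert_of_notMem, Finset.card_pair h6] <;>
      simp [*]
  omega
open Classical in
lemma three_le {V : Type*} {B : Finset V} {a b c : V} (ha : a ∈ B) (hb : b ∈ B) (hc : c ∈ B)
    (h1 : a ≠ b) (h2 : a ≠ c) (h4 : b ≠ c) : 3 ≤ B.card := by
  have : ({a, b, c} : Finset V) ⊆ B := by
    intro v hv
    simp only [Finset.mem_insert, Finset.mem_singleton] at hv
    rcases hv with rfl | rfl | rfl <;> assumption
  have h := Finset.card_le_card this
  have h4 : ({a, b, c} : Finset V).card = 3 := by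
    rw [Finset.card_insert_of_notMem, Finset.card_pair h4]
    simp [*]
  omega

/-- structure of a minimum 2-dominating set -/
structure Good {V : Type*} (G : SimpleGraph V) (D : Finset V) : Prop where
  indep : ∀ u ∈ D, ∀ w ∈ D, ¬ G.Adj u w
  two : ∀ x, x ∉ D → ∃ a ∈ D, ∃ b ∈ D, a ≠ b ∧ G.Adj x a ∧ G.Adj x b
  cherry : ∀ x, x ∉ D → ∀ u ∈ D, ∀ w ∈ D, u ≠ w → G.Adj x u → G.Adj x w →
    ∃ y, y ∉ D ∧ y ≠ x ∧ ¬ G.Adj y x ∧ G.Adj y u ∧ G.Adj y w ∧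
      ∀ z ∈ D, G.Adj y z → z = u ∨ z = w

open Classical in
lemma exists_good {V : Type*} [Fintype V] {G : SimpleGraph V} (hP : Perf G)
    (hd : RDeg G Finset.univ) : ∃ D, Good G D := by
  obtain ⟨D, hD, hmin⟩ := hP _ hd
  have two : ∀ x, x ∉ D → ∃ a ∈ D, ∃ b ∈ D, a ≠ b ∧ G.Adj x a ∧ G.Adj x b :=
    fun x hx => hD.2 x (Finset.mem_univ _) hx
  refine ⟨D, ?_, two, ?_⟩
  · intro u hu w hw hadj
    have := hmin (D.erase u) ⟨Finset.subset_univ _, by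
      intro v _ hv
      by_cases hvu : v = u
      · subst hvu
        exact ⟨w, Finset.mem_erase.2 ⟨hadj.ne', hw⟩, hadj⟩
      · have hvD : v ∉ D := fun h => hv (Finset.mem_erase.2 ⟨hvu, h⟩)
        obtain ⟨a, ha, b, hb, hab, h1, h2⟩ := two v hvD
        by_cases hau : a = u
        · exact ⟨b, Finset.mem_erase.2 ⟨fun h => hab (hau.trans h.symm), hb⟩, h2⟩
        · exact ⟨a, Finset.mem_erase.2 ⟨hau, ha⟩, h1⟩⟩
    have := Finset.card_erase_lt_of_mem hu
    omega
  · intro x hx u hu w hw huw hxu hxw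
    by_contra! hcon
    have := hmin (insert x ((D.erase u).erase w)) ⟨Finset.subset_univ _, by
      intro v _ hv
      simp only [Finset.mem_insert, Finset.mem_erase] at hv
      push Not at hv
      by_cases hvu : v = u
      · subst hvu
        exact ⟨x, by simp, hxu.symm⟩
      by_cases hvw : v = w
      · subst hvw
        exact ⟨x, by simp, hxw.symm⟩
      have hvD : v ∉ D := hv.2 hvw hvu
      by_cases hvx : G.Adj v x
      · exact ⟨x, by simp, hvx⟩
      have : ∃ z ∈ D, G.Adj v z ∧ z ≠ u ∧ z ≠ w := by
        by_contra! h
        obtain ⟨a, ha, b, hb, hab, h1, h2⟩ := two v hvD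
        have hvu : G.Adj v u := by
          by_contra hn
          have ha' : a = w := h a ha h1 (by rintro rfl; exact hn h1)
          have hb' : b = w := h b hb h2 (by rintro rfl; exact hn h2)
          exact hab (ha'.trans hb'.symm)
        have hvw : G.Adj v w := by
          by_contra hn
          have ha' : a = u := by
            by_contra hne; exact hn (h a ha h1 hne ▸ h1)
          have hb' : b = u := by
            by_contra hne; exact hn (h b hb h2 hne ▸ h2)
          exact hab (ha'.trans hb'.symm)
        obtain ⟨z, hz, h3, h4, h5⟩ := hcon v hvD hv.1 hvx hvu hvw
        exact h5 (h z hz h3 h4)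
      obtain ⟨z, hz, h1, h2, h3⟩ := this
      exact ⟨z, by simp [*], h1⟩⟩
    have h1 := Finset.card_erase_lt_of_mem hu
    have h2 := Finset.card_erase_lt_of_mem (Finset.mem_erase.2 ⟨huw.symm, hw⟩ : w ∈ D.erase u)
    have h3 := Finset.card_insert_le x ((D.erase u).erase w)
    omega

open Classical in
lemma no_C6 {V : Type*} {G : SimpleGraph V} (hP : Perf G) {D : Finset V} (hD : Good G D)
    {u w t p q r : V} (hu : u ∈ D) (hw : w ∈ D) (ht : t ∈ D)
    (hp : p ∉ D) (hq : q ∉ D) (hr : r ∉ D) (huw : u ≠ w) (hut : u ≠ t) (hwt : w ≠ t)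
    (hpu : G.Adj p u) (hpw : G.Adj p w) (hqw : G.Adj q w) (hqt : G.Adj q t)
    (hru : G.Adj r u) (hrt : G.Adj r t)
    (hpt : ¬ G.Adj p t) (hqu : ¬ G.Adj q u) (hrw : ¬ G.Adj r w) : False := by
  have hpq : ¬ G.Adj p q := fun h => no_triangle hP h hqw hpw
  have hpr : ¬ G.Adj p r := fun h => no_triangle hP h hru hpu
  have hqr : ¬ G.Adj q r := fun h => no_triangle hP h hrt hqt
  have iuw := hD.indep u hu w hw
  have iut := hD.indep u hu t ht
  have iwt := hD.indep w hw t ht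
  have npq : p ≠ q := by rintro rfl; exact hpt hqt
  have npr : p ≠ r := by rintro rfl; exact hpt hrt
  have nqr : q ≠ r := by rintro rfl; exact hqu hru
  have nD : ∀ x ∈ D, ∀ y, y ∉ D → x ≠ y := by rintro x hx y hy rfl; exact hy hx
  have c1 := hpu.symm
  have c2 := hpw.symm
  have c3 := hqw.symm
  have c4 := hqt.symm
  have c5 := hru.symm
  have c6 := hrt.symm
  obtain ⟨B, hB, hmin⟩ := hP {u, w, t, p, q, r} (by
    intro v hv
    simp only [Finset.mem_insert, Finset.mem_singleton] at hv
    rcases hv with rfl | rfl | rfl | rfl | rfl | rfl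
    · exact ⟨p, by simp, r, by simp, npr, c1, c5⟩
    · exact ⟨p, by simp, q, by simp, npq, c2, c3⟩
    · exact ⟨q, by simp, r, by simp, nqr, c4, c6⟩
    · exact ⟨u, by simp, w, by simp, huw, hpu, hpw⟩
    · exact ⟨w, by simp, t, by simp, hwt, hqw, hqt⟩
    · exact ⟨u, by simp, t, by simp, hut, hru, hrt⟩)
  have h1 := hmin {u, q} ⟨by intro v hv; simp at hv ⊢; tauto, by
    intro v hv hva
    simp only [Finset.mem_insert, Finset.mem_singleton] at hv hva
    rcases hv with rfl | rfl | rfl | rfl | rfl | rfl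
    · simp at hva
    · exact ⟨q, by simp, c3⟩
    · exact ⟨q, by simp, c4⟩
    · exact ⟨u, by simp, hpu⟩
    · simp at hva
    · exact ⟨u, by simp, hru⟩⟩
  have h2 : ({u, q} : Finset V).card ≤ 2 := Finset.card_le_two
  have aux : ∀ a ∈ ({u, w, t, p, q, r} : Finset V), ∀ b c, a ∉ B →
      (∀ z ∈ ({u, w, t, p, q, r} : Finset V), G.Adj a z → z = b ∨ z = c) → b ∈ B := by
    intro a ha b c haB hn
    obtain ⟨y, hy, z, hz, hyz, h3, h4⟩ := hB.2 a ha haB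
    rcases hn y (hB.1 hy) h3 with rfl | rfl
    · exact hy
    · rcases hn z (hB.1 hz) h4 with rfl | rfl
      · exact hz
      · exact absurd rfl hyz
  have a1 : u ∈ B ∨ p ∈ B := by
    by_contra! h
    refine h.2 (aux u (by simp) p r h.1 ?_)
    intro z hz hadj
    simp only [Finset.mem_insert, Finset.mem_singleton] at hz
    rcases hz with rfl | rfl | rfl | rfl | rfl | rfl <;>
      first
      | exact Or.inl rfl
      | exact Or.inr rfl
      | exact absurd rfl hadj.ne
      | exact absurd hadj (by assumption)
      | exact absurd hadj.symm (by assumption)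
  have a2 : w ∈ B ∨ q ∈ B := by
    by_contra! h
    refine h.2 (aux w (by simp) q p h.1 ?_)
    intro z hz hadj
    simp only [Finset.mem_insert, Finset.mem_singleton] at hz
    rcases hz with rfl | rfl | rfl | rfl | rfl | rfl <;>
      first
      | exact Or.inl rfl
      | exact Or.inr rfl
      | exact absurd rfl hadj.ne
      | exact absurd hadj (by assumption)
      | exact absurd hadj.symm (by assumption)
  have a3 : t ∈ B ∨ r ∈ B := by
    by_contra! h
    refine h.2 (aux t (by simp) r q h.1 ?_)
    intro z hz hadj
    simp only [Finset.mem_insert, Finset.mem_singleton] at hz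
    rcases hz with rfl | rfl | rfl | rfl | rfl | rfl <;>
      first
      | exact Or.inl rfl
      | exact Or.inr rfl
      | exact absurd rfl hadj.ne
      | exact absurd hadj (by assumption)
      | exact absurd hadj.symm (by assumption)
  have : 3 ≤ B.card := by
    rcases a1 with a1 | a1 <;> rcases a2 with a2 | a2 <;> rcases a3 with a3 | a3 <;>
    · refine three_le a1 a2 a3 ?_ ?_ ?_ <;>
      first | assumption | exact nD _ ‹_› _ ‹_› | exact (nD _ ‹_› _ ‹_›).symm
  omega

lemma good_exact {V : Type*} {G : SimpleGraph V} (hP : Perf G) {D : Finset V} (hD : Good G D)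
    {x u w t : V} (hx : x ∉ D) (hu : u ∈ D) (hw : w ∈ D) (ht : t ∈ D) (huw : u ≠ w)
    (hxu : G.Adj x u) (hxw : G.Adj x w) (hxt : G.Adj x t) : t = u ∨ t = w := by
  by_contra! h
  obtain ⟨p, hp, -, -, hpu, hpw, hpz⟩ := hD.cherry x hx u hu w hw huw hxu hxw
  obtain ⟨q, hq, -, -, hqw, hqt, hqz⟩ := hD.cherry x hx w hw t ht h.2.symm hxw hxt
  obtain ⟨r, hr, -, -, hru, hrt, hrz⟩ := hD.cherry x hx u hu t ht h.1.symm hxu hxt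
  refine no_C6 hP hD hu hw ht hp hq hr huw h.1.symm h.2.symm hpu hpw hqw hqt hru hrt ?_ ?_ ?_
  · intro h'; rcases hpz t ht h' with h' | h'
    · exact h.1 h'
    · exact h.2 h'
  · intro h'; rcases hqz u hu h' with h' | h'
    · exact huw h'
    · exact h.1 h'.symm
  · intro h'; rcases hrz w hw h' with h' | h'
    · exact huw h'.symm
    · exact h.2 h'.symm

open Classical in
lemma good_indep {V : Type*} {G : SimpleGraph V} (hP : Perf G) {D : Finset V} (hD : Good G D)
    {x x' : V} (hx : x ∉ D) (hx' : x' ∉ D) (hxx : G.Adj x x') : False := by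
  obtain ⟨u, hu, w, hw, huw, hxu, hxw⟩ := hD.two x hx
  obtain ⟨s, hs, t, ht, hst, hxs, hxt⟩ := hD.two x' hx'
  obtain ⟨y, hy, hyx, -, hyu, hyw, -⟩ := hD.cherry x hx u hu w hw huw hxu hxw
  obtain ⟨y', hy', hyx', -, hys, hyt, -⟩ := hD.cherry x' hx' s hs t ht hst hxs hxt
  have nD : ∀ x ∈ D, ∀ y, y ∉ D → x ≠ y := by rintro x hx y hy rfl; exact hy hx
  have dj : ∀ z, G.Adj x z → ¬ G.Adj x' z := fun z h1 h2 => no_triangle hP hxx h2 h1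
  have nus : u ≠ s := by rintro rfl; exact dj _ hxu hxs
  have nut : u ≠ t := by rintro rfl; exact dj _ hxu hxt
  have nws : w ≠ s := by rintro rfl; exact dj _ hxw hxs
  have nwt : w ≠ t := by rintro rfl; exact dj _ hxw hxt
  have key : ∀ a ∈ D, ∀ b ∈ D, a ≠ b → ∀ z, z ∉ D → G.Adj z a → G.Adj z b →
      ∀ c ∈ D, c ≠ a → c ≠ b → ¬ G.Adj z c := by
    intro a ha b hb hab z hz h1 h2 c hc h3 h4 h5
    rcases good_exact hP hD hz ha hb hc hab h1 h2 h5 with h | h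
    · exact h3 h
    · exact h4 h
  have nyx' : x' ≠ y := by
    rintro rfl; exact key s hs t ht hst _ hx' hxs hxt u hu nus nut hyu
  have nxy' : x ≠ y' := by
    rintro rfl; exact key s hs t ht hst _ hx hys hyt u hu nus nut hxu
  have nyy' : y ≠ y' := by
    rintro rfl; exact key s hs t ht hst _ hy hys hyt u hu nus nut hyu
  obtain ⟨B, hB, hmin⟩ := hP {u, w, s, t, x, x', y, y'} (by
    intro v hv
    simp only [Finset.mem_insert, Finset.mem_singleton] at hv
    rcases hv with rfl | rfl | rfl | rfl | rfl | rfl | rfl | rfl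
    · exact ⟨x, by simp, y, by simp, hyx.symm, hxu.symm, hyu.symm⟩
    · exact ⟨x, by simp, y, by simp, hyx.symm, hxw.symm, hyw.symm⟩
    · exact ⟨x', by simp, y', by simp, hyx'.symm, hxs.symm, hys.symm⟩
    · exact ⟨x', by simp, y', by simp, hyx'.symm, hxt.symm, hyt.symm⟩
    · exact ⟨u, by simp, w, by simp, huw, hxu, hxw⟩
    · exact ⟨s, by simp, t, by simp, hst, hxs, hxt⟩
    · exact ⟨u, by simp, w, by simp, huw, hyu, hyw⟩
    · exact ⟨s, by simp, t, by simp, hst, hys, hyt⟩)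
  have h1 := hmin {x, y, y'} ⟨by intro v hv; simp at hv ⊢; tauto, by
    intro v hv hva
    simp only [Finset.mem_insert, Finset.mem_singleton] at hv hva
    rcases hv with rfl | rfl | rfl | rfl | rfl | rfl | rfl | rfl
    · exact ⟨x, by simp, hxu.symm⟩
    · exact ⟨x, by simp, hxw.symm⟩
    · exact ⟨y', by simp, hys.symm⟩
    · exact ⟨y', by simp, hyt.symm⟩
    · simp at hva
    · exact ⟨x, by simp, hxx.symm⟩
    · simp at hva
    · simp at hva⟩
  have h2 : ({x, y, y'} : Finset V).card ≤ 3 := Finset.card_le_three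
  have nb : ∀ c ∈ D, ∀ z ∈ ({u, w, s, t, x, x', y, y'} : Finset V), G.Adj c z →
      z = x ∨ z = x' ∨ z = y ∨ z = y' := by
    intro c hc z hz hadj
    simp only [Finset.mem_insert, Finset.mem_singleton] at hz
    rcases hz with rfl | rfl | rfl | rfl | h
    · exact absurd hadj (hD.indep _ hc _ hu)
    · exact absurd hadj (hD.indep _ hc _ hw)
    · exact absurd hadj (hD.indep _ hc _ hs)
    · exact absurd hadj (hD.indep _ hc _ ht)
    · exact h
  have A1 : ∀ c ∈ D, c ≠ s → c ≠ t → ∀ z ∈ ({u, w, s, t, x, x', y, y'} : Finset V), G.Adj c z →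
      z = x ∨ z = y := by
    intro c hc h3 h4 z hz hadj
    rcases nb c hc z hz hadj with rfl | rfl | rfl | rfl
    · simp
    · exact absurd hadj.symm (key s hs t ht hst _ hx' hxs hxt c hc h3 h4)
    · simp
    · exact absurd hadj.symm (key s hs t ht hst _ hy' hys hyt c hc h3 h4)
  have A2 : ∀ c ∈ D, c ≠ u → c ≠ w → ∀ z ∈ ({u, w, s, t, x, x', y, y'} : Finset V), G.Adj c z →
      z = x' ∨ z = y' := by
    intro c hc h3 h4 z hz hadj
    rcases nb c hc z hz hadj with rfl | rfl | rfl | rfl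
    · exact absurd hadj.symm (key u hu w hw huw _ hx hxu hxw c hc h3 h4)
    · simp
    · exact absurd hadj.symm (key u hu w hw huw _ hy hyu hyw c hc h3 h4)
    · simp
  have P1 := pair_cases hB (u := u) (w := w) (by simp) (by simp) (A1 u hu nus nut) (A1 w hw nws nwt)
  have P2 := pair_cases hB (u := s) (w := t) (by simp) (by simp)
    (A2 s hs nus.symm nws.symm) (A2 t ht nut.symm nwt.symm)
  have : 4 ≤ B.card := by
    rcases P1 with ⟨p1, p2⟩ | ⟨p1, p2⟩ <;> rcases P2 with ⟨p3, p4⟩ | ⟨p3, p4⟩ <;>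
    · refine four_le p1 p2 p3 p4 ?_ ?_ ?_ ?_ ?_ ?_ <;>
      first | assumption | (symm; assumption) | exact hxx.ne | exact nD _ ‹_› _ ‹_› |
        exact (nD _ ‹_› _ ‹_›).symm
  omega

open Classical in
lemma no_P4 {V : Type*} {G : SimpleGraph V} (hP : Perf G) {D : Finset V} (hD : Good G D)
    {b a d e x z x' : V} (hb : b ∈ D) (ha : a ∈ D) (hd : d ∈ D) (he : e ∈ D)
    (hba : b ≠ a) (hbd : b ≠ d) (hbe : b ≠ e) (had : a ≠ d) (hae : a ≠ e) (hde : d ≠ e)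
    (hx : x ∉ D) (hz : z ∉ D) (hx' : x' ∉ D)
    (hxb : G.Adj x b) (hxa : G.Adj x a) (hza : G.Adj z a) (hzd : G.Adj z d)
    (hxd : G.Adj x' d) (hxe : G.Adj x' e) : False := by
  obtain ⟨y, hy, hyx, -, hyb, hya, -⟩ := hD.cherry x hx b hb a ha hba hxb hxa
  obtain ⟨y', hy', hyx', -, hyd, hye, -⟩ := hD.cherry x' hx' d hd e he hde hxd hxe
  have nD : ∀ x ∈ D, ∀ y, y ∉ D → x ≠ y := by rintro x hx y hy rfl; exact hy hx
  have key : ∀ a ∈ D, ∀ b ∈ D, a ≠ b → ∀ z, z ∉ D → G.Adj z a → G.Adj z b →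
      ∀ c ∈ D, c ≠ a → c ≠ b → ¬ G.Adj z c := by
    intro a ha b hb hab z hz h1 h2 c hc h3 h4 h5
    rcases good_exact hP hD hz ha hb hc hab h1 h2 h5 with h | h
    · exact h3 h
    · exact h4 h
  have nxx : x ≠ x' := by
    rintro rfl; exact key d hd e he hde _ hx hxd hxe a ha had hae hxa
  have nyx' : x' ≠ y := by
    rintro rfl; exact key d hd e he hde _ hy hxd hxe a ha had hae hya
  have nxy' : x ≠ y' := by
    rintro rfl; exact key d hd e he hde _ hx hyd hye a ha had hae hxa
  have nyy' : y ≠ y' := by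
    rintro rfl; exact key d hd e he hde _ hy hyd hye a ha had hae hya
  have nzx : x ≠ z := by
    rintro rfl; exact key a ha d hd had _ hx hza hzd b hb hba hbd hxb
  have nzx' : x' ≠ z := by
    rintro rfl; exact key d hd e he hde _ hz hxd hxe a ha had hae hza
  obtain ⟨B, hB, hmin⟩ := hP {b, a, d, e, z, x, x', y, y'} (by
    intro v hv
    simp only [Finset.mem_insert, Finset.mem_singleton] at hv
    rcases hv with rfl | rfl | rfl | rfl | rfl | rfl | rfl | rfl | rfl
    · exact ⟨x, by simp, y, by simp, hyx.symm, hxb.symm, hyb.symm⟩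
    · exact ⟨x, by simp, y, by simp, hyx.symm, hxa.symm, hya.symm⟩
    · exact ⟨x', by simp, y', by simp, hyx'.symm, hxd.symm, hyd.symm⟩
    · exact ⟨x', by simp, y', by simp, hyx'.symm, hxe.symm, hye.symm⟩
    · exact ⟨a, by simp, d, by simp, had, hza, hzd⟩
    · exact ⟨b, by simp, a, by simp, hba, hxb, hxa⟩
    · exact ⟨d, by simp, e, by simp, hde, hxd, hxe⟩
    · exact ⟨b, by simp, a, by simp, hba, hyb, hya⟩
    · exact ⟨d, by simp, e, by simp, hde, hyd, hye⟩)
  have h1 := hmin {b, z, e} ⟨by intro v hv; simp at hv ⊢; tauto, by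
    intro v hv hva
    simp only [Finset.mem_insert, Finset.mem_singleton] at hv hva
    rcases hv with rfl | rfl | rfl | rfl | rfl | rfl | rfl | rfl | rfl
    · simp at hva
    · exact ⟨z, by simp, hza.symm⟩
    · exact ⟨z, by simp, hzd.symm⟩
    · simp at hva
    · simp at hva
    · exact ⟨b, by simp, hxb⟩
    · exact ⟨e, by simp, hxe⟩
    · exact ⟨b, by simp, hyb⟩
    · exact ⟨e, by simp, hye⟩⟩
  have h2 : ({b, z, e} : Finset V).card ≤ 3 := Finset.card_le_three
  have A1 : ∀ v, v ∉ D → G.Adj v b → G.Adj v a →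
      ∀ c ∈ ({b, a, d, e, z, x, x', y, y'} : Finset V), G.Adj v c → c = b ∨ c = a := by
    intro v hv h3 h4 c hc hadj
    by_cases hcD : c ∈ D
    · exact good_exact hP hD hv hb ha hcD hba h3 h4 hadj
    · exact (good_indep hP hD hv hcD hadj).elim
  have A2 : ∀ v, v ∉ D → G.Adj v d → G.Adj v e →
      ∀ c ∈ ({b, a, d, e, z, x, x', y, y'} : Finset V), G.Adj v c → c = d ∨ c = e := by
    intro v hv h3 h4 c hc hadj
    by_cases hcD : c ∈ D
    · exact good_exact hP hD hv hd he hcD hde h3 h4 hadj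
    · exact (good_indep hP hD hv hcD hadj).elim
  have P1 := pair_cases hB (u := x) (w := y) (by simp) (by simp) (A1 x hx hxb hxa) (A1 y hy hyb hya)
  have P2 := pair_cases hB (u := x') (w := y') (by simp) (by simp)
    (A2 x' hx' hxd hxe) (A2 y' hy' hyd hye)
  have : 4 ≤ B.card := by
    rcases P1 with ⟨p1, p2⟩ | ⟨p1, p2⟩ <;> rcases P2 with ⟨p3, p4⟩ | ⟨p3, p4⟩ <;>
    · refine four_le p1 p2 p3 p4 ?_ ?_ ?_ ?_ ?_ ?_ <;>
      first | assumption | (symm; assumption) | exact nD _ ‹_› _ ‹_› |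
        exact (nD _ ‹_› _ ‹_›).symm
  omega
lemma good_star {V : Type*} {G : SimpleGraph V} (hP : Perf G) {D : Finset V} (hD : Good G D)
    (hconn : G.Connected) (hd : ∀ v, ∃ w, G.Adj v w) :
    ∃ c ∈ D, ∀ x, x ∉ D → G.Adj x c := by
  have hX : ∃ x, x ∉ D := by
    obtain ⟨v⟩ := hconn.nonempty
    obtain ⟨w, hw⟩ := hd v
    by_contra! h
    exact hD.indep v (h v) w (h w) hw
  have inter : ∀ x, x ∉ D → ∀ a ∈ D, ∀ b ∈ D, a ≠ b → G.Adj x a → G.Adj x b →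
      ∀ y, y ∉ D → G.Adj y a ∨ G.Adj y b := by
    intro x hx a ha b hb hab hxa hxb
    have T : ∀ v, Relation.ReflTransGen G.Adj x v →
        (v ∉ D → G.Adj v a ∨ G.Adj v b) ∧
        (v ∈ D → v = a ∨ v = b ∨ ∃ z, z ∉ D ∧ G.Adj z v ∧ (G.Adj z a ∨ G.Adj z b)) := by
      intro v hv
      induction hv with
      | refl => exact ⟨fun _ => Or.inl hxa, fun h => absurd h hx⟩
      | @tail p q _ hpq ih =>
        by_cases hp : p ∈ D
        · have hq : q ∉ D := fun h => hD.indep p hp q h hpq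
          refine ⟨fun _ => ?_, fun h => absurd h hq⟩
          rcases ih.2 hp with rfl | rfl | ⟨z, hz, hzp, hzab⟩
          · exact Or.inl hpq.symm
          · exact Or.inr hpq.symm
          · by_contra! hcon
            by_cases hpa : p = a
            · exact hcon.1 (hpa ▸ hpq.symm)
            by_cases hpb : p = b
            · exact hcon.2 (hpb ▸ hpq.symm)
            have : ∃ e ∈ D, e ≠ p ∧ G.Adj q e := by
              obtain ⟨s, hs, t, ht, hst, h1, h2⟩ := hD.two q hq
              by_cases hsp : s = p
              · exact ⟨t, ht, fun h => hst (hsp.trans h.symm), h2⟩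
              · exact ⟨s, hs, hsp, h1⟩
            obtain ⟨e, he, hep, hqe⟩ := this
            have hea : e ≠ a := by rintro rfl; exact hcon.1 hqe
            have heb : e ≠ b := by rintro rfl; exact hcon.2 hqe
            rcases hzab with hza | hzb
            · exact no_P4 hP hD hb ha hp he hab.symm (Ne.symm hpb) heb.symm (Ne.symm hpa)
                hea.symm hep.symm hx hz hq hxb hxa hza hzp hpq.symm hqe
            · exact no_P4 hP hD ha hb hp he hab (Ne.symm hpa) hea.symm (Ne.symm hpb)
                heb.symm hep.symm hx hz hq hxa hxb hzb hzp hpq.symm hqe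
        · have hq : q ∈ D := by
            by_contra h; exact good_indep hP hD hp h hpq
          exact ⟨fun h => absurd hq h, fun _ => Or.inr (Or.inr ⟨p, hp, hpq, ih.1 hp⟩)⟩
    intro y hy
    exact (T y ((SimpleGraph.reachable_iff_reflTransGen _ _).1 (hconn.preconnected x y))).1 hy
  obtain ⟨x, hx⟩ := hX
  obtain ⟨a, ha, b, hb, hab, hxa, hxb⟩ := hD.two x hx
  by_contra! hcon
  obtain ⟨y, hy, hya⟩ := hcon a ha
  obtain ⟨z, hz, hzb⟩ := hcon b hb
  have hyb := (inter x hx a ha b hb hab hxa hxb y hy).resolve_left hya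
  have hza := (inter x hx a ha b hb hab hxa hxb z hz).resolve_right hzb
  have : ∃ e ∈ D, e ≠ b ∧ G.Adj y e := by
    obtain ⟨s, hs, t, ht, hst, h1, h2⟩ := hD.two y hy
    by_cases hsp : s = b
    · exact ⟨t, ht, fun h => hst (hsp.trans h.symm), h2⟩
    · exact ⟨s, hs, hsp, h1⟩
  obtain ⟨e, he, heb, hye⟩ := this
  have hea : e ≠ a := by rintro rfl; exact hya hye
  have hze := (inter y hy b hb e he heb.symm hyb hye z hz).resolve_left hzb
  refine no_C6 hP hD ha hb he hx hy hz hab hea.symm heb.symm hxa hxb hyb hye hza hze ?_ hya hzb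
  intro h
  rcases good_exact hP hD hx ha hb he hab hxa hxb h with h | h
  · exact hea h
  · exact heb h

lemma Sgraph_hub_x {k : ℕ} {f : Fin k → ℕ} (p : Σ j : Fin k, Fin (f j)) :
    (Sgraph k f).Adj (Sum.inl none) (Sum.inr p) := by simp [Sgraph]
lemma Sgraph_x_hub {k : ℕ} {f : Fin k → ℕ} (p : Σ j : Fin k, Fin (f j)) :
    (Sgraph k f).Adj (Sum.inr p) (Sum.inl none) := by simp [Sgraph]
lemma Sgraph_leaf_x {k : ℕ} {f : Fin k → ℕ} (i : Fin k) (p : Σ j : Fin k, Fin (f j)) :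
    (Sgraph k f).Adj (Sum.inl (some i)) (Sum.inr p) ↔ i = p.1 := by simp [Sgraph]
lemma Sgraph_x_leaf {k : ℕ} {f : Fin k → ℕ} (i : Fin k) (p : Σ j : Fin k, Fin (f j)) :
    (Sgraph k f).Adj (Sum.inr p) (Sum.inl (some i)) ↔ i = p.1 := by simp [Sgraph]
lemma Sgraph_ll {k : ℕ} {f : Fin k → ℕ} (a b : Option (Fin k)) :
    ¬ (Sgraph k f).Adj (Sum.inl a) (Sum.inl b) := by
  cases a <;> cases b <;> simp [Sgraph]
lemma Sgraph_rr {k : ℕ} {f : Fin k → ℕ} (a b : Σ j : Fin k, Fin (f j)) :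
    ¬ (Sgraph k f).Adj (Sum.inr a) (Sum.inr b) := by
  simp [Sgraph]

open Classical in
lemma inS_of_star {V : Type*} [Fintype V] {G : SimpleGraph V} (hP : Perf G) {D : Finset V}
    (hD : Good G D) (hδ : ∀ x : V, 2 ≤ (G.neighborSet x).ncard)
    {c : V} (hc : c ∈ D) (hcx : ∀ x, x ∉ D → G.Adj x c) : inS G := by
  have nbr : ∀ l ∈ D, ∀ y, G.Adj l y → y ∉ D := fun l hl y h hy => hD.indep l hl y hy h
  let L := {l : V // l ∈ D ∧ l ≠ c}
  let e : L ≃ Fin (Nat.card L) := Finite.equivFin L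
  let X : Fin (Nat.card L) → Type _ := fun j => {x : V // G.Adj (e.symm j).1 x}
  let f : Fin (Nat.card L) → ℕ := fun j => Nat.card (X j)
  let g : ∀ j, X j ≃ Fin (f j) := fun j => Finite.equivFin (X j)
  let ψ : SV (Nat.card L) f → V := fun a => match a with
    | Sum.inl none => c
    | Sum.inl (some j) => (e.symm j).1
    | Sum.inr ⟨j, r⟩ => ((g j).symm r).1
  have hxD : ∀ j r, ((g j).symm r).1 ∉ D := fun j r =>
    nbr _ (e.symm j).2.1 _ ((g j).symm r).2
  have leaf : ∀ i j r, G.Adj ((g j).symm r).1 (e.symm i).1 → i = j := by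
    intro i j r h
    rcases good_exact hP hD (hxD j r) hc (e.symm j).2.1 (e.symm i).2.1 (e.symm j).2.2.symm
      (hcx _ (hxD j r)) ((g j).symm r).2.symm h with h | h
    · exact absurd h (e.symm i).2.2
    · exact e.symm.injective (Subtype.ext h)
  have inj : Function.Injective ψ := by
    rintro ((_ | i) | ⟨i, r⟩) ((_ | j) | ⟨j, t⟩) h
    · rfl
    · exact absurd h.symm (e.symm j).2.2
    · have h' : c = ((g j).symm t).1 := h
      exact absurd (h' ▸ hc) (hxD j t)
    · exact absurd h (e.symm i).2.2
    · have : i = j := e.symm.injective (Subtype.ext h)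
      rw [this]
    · have h' : (e.symm i).1 = ((g j).symm t).1 := h
      have h2 := (e.symm i).2.1
      rw [h'] at h2
      exact absurd h2 (hxD j t)
    · have h' : ((g i).symm r).1 = c := h
      have h2 := hxD i r
      rw [h'] at h2
      exact absurd hc h2
    · have h' : ((g i).symm r).1 = (e.symm j).1 := h
      have h2 := (e.symm j).2.1
      rw [← h'] at h2
      exact absurd h2 (hxD i r)
    · have h' : ((g i).symm r).1 = ((g j).symm t).1 := h
      have hij : i = j := by
        apply leaf i j t
        rw [← h']
        exact ((g i).symm r).2.symm
      subst hij
      have : r = t := (g i).symm.injective (Subtype.ext h')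
      rw [this]
  have surj : Function.Surjective ψ := by
    intro v
    by_cases hv : v ∈ D
    · by_cases hvc : v = c
      · exact ⟨Sum.inl none, hvc.symm⟩
      · refine ⟨Sum.inl (some (e ⟨v, hv, hvc⟩)), ?_⟩
        change (e.symm (e ⟨v, hv, hvc⟩)).1 = v
        simp
    · have : ∃ l ∈ D, l ≠ c ∧ G.Adj v l := by
        obtain ⟨s, hs, t, ht, hst, h1, h2⟩ := hD.two v hv
        by_cases hsp : s = c
        · exact ⟨t, ht, fun h => hst (hsp.trans h.symm), h2⟩
        · exact ⟨s, hs, hsp, h1⟩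
      obtain ⟨l, hl, hlc, hvl⟩ := this
      have hadj : G.Adj (e.symm (e ⟨l, hl, hlc⟩)).1 v := by simpa using hvl.symm
      refine ⟨Sum.inr ⟨e ⟨l, hl, hlc⟩, g _ ⟨v, hadj⟩⟩, ?_⟩
      change ((g _).symm (g _ ⟨v, hadj⟩)).1 = v
      simp
  have adj : ∀ a b, G.Adj (ψ a) (ψ b) ↔ (Sgraph _ f).Adj a b := by
    have hl : ∀ o : Option (Fin (Nat.card L)), ψ (Sum.inl o) ∈ D := by
      rintro (_ | i)
      · exact hc
      · exact (e.symm i).2.1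
    have hx : ∀ (o : Option (Fin (Nat.card L))) p, G.Adj (ψ (Sum.inl o)) (ψ (Sum.inr p)) ↔
        (Sgraph _ f).Adj (Sum.inl o) (Sum.inr p) := by
      rintro (_ | i) ⟨j, r⟩
      · exact iff_of_true (hcx _ (hxD j r)).symm (Sgraph_hub_x _)
      · rw [Sgraph_leaf_x]
        constructor
        · intro h; exact leaf i j r h.symm
        · rintro h
          have h : i = j := h
          subst h
          exact ((g i).symm r).2
    rintro (o | p) (o' | p')
    · exact iff_of_false (hD.indep _ (hl o) _ (hl o')) (Sgraph_ll _ _)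
    · exact hx o p'
    · rw [SimpleGraph.adj_comm, hx o' p, SimpleGraph.adj_comm]
    · exact iff_of_false (fun h => good_indep hP hD (hxD _ _) (hxD _ _) h) (Sgraph_rr _ _)
  refine ⟨Nat.card L, f, ?_, ?_, ⟨RelIso.symm ⟨Equiv.ofBijective ψ ⟨inj, surj⟩, ?_⟩⟩⟩
  · have : Nonempty L := by
      obtain ⟨y, hy⟩ := (Set.ncard_pos (Set.toFinite _)).1 (lt_of_lt_of_le two_pos (hδ c))
      obtain ⟨s, hs, t, ht, hst, h1, h2⟩ := hD.two y (nbr c hc y hy)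
      by_cases hsp : s = c
      · exact ⟨⟨t, ht, fun h => hst (hsp.trans h.symm)⟩⟩
      · exact ⟨⟨s, hs, hsp⟩⟩
    exact Nat.card_pos
  · intro j
    exact hδ (e.symm j).1
  · intro a b
    exact adj a b

/-- block of a vertex -/
def blk {k : ℕ} {f : Fin k → ℕ} : SV k f → Option (Fin k)
  | Sum.inl o => o
  | Sum.inr p => some p.1

open Classical in
lemma perf_of_S {V : Type*} [Fintype V] {G : SimpleGraph V} (h : inS G) : Perf G := by
  obtain ⟨k, f, -, -, ⟨e⟩⟩ := h
  intro s hs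
  have tr : ∀ a b, G.Adj (e.symm a) (e.symm b) ↔ (Sgraph k f).Adj a b := fun a b =>
    e.symm.map_rel_iff
  have tr' : ∀ a b, G.Adj a b ↔ (Sgraph k f).Adj (e a) (e b) := fun a b =>
    e.map_rel_iff.symm
  -- in `s`, an `x` vertex has hub and leaf
  have hx : ∀ p, e.symm (Sum.inr p) ∈ s →
      e.symm (Sum.inl none) ∈ s ∧ e.symm (Sum.inl (some p.1)) ∈ s := by
    intro p hp
    have aux : ∀ a, G.Adj (e.symm (Sum.inr p)) a →
        a = e.symm (Sum.inl none) ∨ a = e.symm (Sum.inl (some p.1)) := by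
      intro a ha
      obtain ⟨a, rfl⟩ := e.symm.surjective a
      rw [tr] at ha
      rcases a with (_ | i) | q
      · exact Or.inl rfl
      · rw [Sgraph_x_leaf] at ha
        rw [ha]; exact Or.inr rfl
      · exact absurd ha (Sgraph_rr _ _)
    obtain ⟨a, ha, b, hb, hab, h1, h2⟩ := hs _ hp
    rcases aux a h1 with rfl | rfl <;> rcases aux b h2 with rfl | rfl
    · exact absurd rfl hab
    · exact ⟨ha, hb⟩
    · exact ⟨hb, ha⟩
    · exact absurd rfl hab
  rcases s.eq_empty_or_nonempty with rfl | ⟨v0, hv0⟩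
  · exact ⟨∅, ⟨by simp, by simp⟩, by simp⟩
  have hl : ∀ o, e.symm (Sum.inl o) ∈ s → ∃ p q : Σ j : Fin k, Fin (f j), p ≠ q ∧
      e.symm (Sum.inr p) ∈ s ∧ e.symm (Sum.inr q) ∈ s ∧
      (Sgraph k f).Adj (Sum.inl o) (Sum.inr p) ∧ (Sgraph k f).Adj (Sum.inl o) (Sum.inr q) := by
    intro o ho
    obtain ⟨a, ha, b, hb, hab, h1, h2⟩ := hs _ ho
    obtain ⟨a, rfl⟩ := e.symm.surjective a
    obtain ⟨b, rfl⟩ := e.symm.surjective b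
    rw [tr] at h1 h2
    rcases a with a | p
    · exact absurd h1 (Sgraph_ll _ _)
    rcases b with b | q
    · exact absurd h2 (Sgraph_ll _ _)
    exact ⟨p, q, fun h => hab (by rw [h]), ha, hb, h1, h2⟩
  have hub : e.symm (Sum.inl none) ∈ s := by
    obtain ⟨a, rfl⟩ := e.symm.surjective v0
    rcases a with o | p
    · obtain ⟨p, -, -, hp, -⟩ := hl o hv0
      exact (hx p hp).1
    · exact (hx p hv0).1
  let J : Finset (Fin k) := Finset.univ.filter fun j => e.symm (Sum.inl (some j)) ∈ s
  have hJ : ∀ j, j ∈ J ↔ e.symm (Sum.inl (some j)) ∈ s := fun j => by simp [J]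
  let g : V → Option (Fin k) := fun v => blk (e v)
  refine ⟨insert (e.symm (Sum.inl none)) (J.image fun j => e.symm (Sum.inl (some j))),
    ⟨?_, ?_⟩, ?_⟩
  · intro v hv
    simp only [Finset.mem_insert, Finset.mem_image] at hv
    rcases hv with rfl | ⟨j, hj, rfl⟩
    · exact hub
    · exact (hJ j).1 hj
  · intro v hv hvB
    obtain ⟨a, rfl⟩ := e.symm.surjective v
    simp only [Finset.mem_insert, Finset.mem_image] at hvB
    push Not at hvB
    rcases a with (_ | i) | p
    · exact absurd rfl hvB.1
    · exact absurd rfl (hvB.2 i ((hJ i).2 hv))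
    · refine ⟨e.symm (Sum.inl none), by simp, e.symm (Sum.inl (some p.1)), ?_, ?_, ?_, ?_⟩
      · exact Finset.mem_insert_of_mem (Finset.mem_image_of_mem _ ((hJ _).2 (hx p hv).2))
      · intro h
        have := e.symm.injective h
        simp at this
      · exact (tr _ _).2 (Sgraph_x_hub _)
      · exact (tr _ _).2 ((Sgraph_x_leaf _ _).2 rfl)
  · intro A hA
    have hBc : (insert (e.symm (Sum.inl none))
        (J.image fun j => e.symm (Sum.inl (some j)))).card ≤ J.card + 1 :=
      (Finset.card_insert_le _ _).trans (Nat.add_le_add_right Finset.card_image_le 1)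
    refine hBc.trans ?_
    -- each block in `J` is hit
    have hit : ∀ j ∈ J, e.symm (Sum.inl (some j)) ∈ A ∨
        ∃ r, e.symm (Sum.inr ⟨j, r⟩) ∈ A := by
      intro j hj
      by_contra! hcon
      obtain ⟨a, ha, h1⟩ := hA.2 _ ((hJ j).1 hj) hcon.1
      obtain ⟨a, rfl⟩ := e.symm.surjective a
      rw [tr] at h1
      rcases a with a | ⟨i, r⟩
      · exact Sgraph_ll _ _ h1
      · rw [Sgraph_leaf_x] at h1
        have h1 : j = i := h1
        subst h1
        exact hcon.2 r ha
    by_cases hcA : e.symm (Sum.inl none) ∈ A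
    · have : insert none (J.image some) ⊆ A.image g := by
        intro o ho
        simp only [Finset.mem_insert, Finset.mem_image] at ho
        rcases ho with rfl | ⟨j, hj, rfl⟩
        · exact Finset.mem_image.2 ⟨_, hcA, by simp [g, blk]⟩
        · rcases hit j hj with h | ⟨r, h⟩
          · exact Finset.mem_image.2 ⟨_, h, by simp [g, blk]⟩
          · exact Finset.mem_image.2 ⟨_, h, by simp [g, blk]⟩
      have h1 := Finset.card_le_card this
      rw [Finset.card_insert_of_notMem (by simp),
        Finset.card_image_of_injective _ (Option.some_injective _)] at h1
      exact h1.trans Finset.card_image_le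
    · obtain ⟨a, ha, h1⟩ := hA.2 _ hub hcA
      obtain ⟨a, rfl⟩ := e.symm.surjective a
      rw [tr] at h1
      rcases a with a | p
      · exact absurd h1 (Sgraph_ll _ _)
      have hpJ := (hx p (hA.1 ha)).2
      -- another element of A in the block of p
      have other : ∃ b ∈ A, b ≠ e.symm (Sum.inr p) ∧ g b = some p.1 := by
        obtain ⟨q1, q2, hq, hq1, hq2, a1, a2⟩ := hl _ hpJ
        have : ∃ q : Σ j : Fin k, Fin (f j), q ≠ p ∧ e.symm (Sum.inr q) ∈ s ∧ p.1 = q.1 := by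
          rw [Sgraph_leaf_x] at a1 a2
          by_cases h : q1 = p
          · exact ⟨q2, fun h' => hq (h.trans h'.symm), hq2, a2⟩
          · exact ⟨q1, h, hq1, a1⟩
        obtain ⟨q, hqp, hqs, hpq⟩ := this
        by_cases hqA : e.symm (Sum.inr q) ∈ A
        · refine ⟨_, hqA, fun h => hqp ?_, by simp [g, blk, hpq]⟩
          simpa using e.symm.injective h
        · obtain ⟨b, hb, hb1⟩ := hA.2 _ hqs hqA
          obtain ⟨b, rfl⟩ := e.symm.surjective b
          rw [tr] at hb1
          rcases b with (_ | i) | b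
          · exact absurd hb hcA
          · rw [Sgraph_x_leaf] at hb1
            refine ⟨_, hb, fun h => ?_, by simp [g, blk, hpq, hb1]⟩
            have := e.symm.injective h
            simp at this
          · exact absurd hb1 (Sgraph_rr _ _)
      obtain ⟨b, hbA, hbp, hgb⟩ := other
      have : J.image some ⊆ (A.erase (e.symm (Sum.inr p))).image g := by
        intro o ho
        simp only [Finset.mem_image] at ho
        obtain ⟨j, hj, rfl⟩ := ho
        by_cases hjp : j = p.1
        · exact Finset.mem_image.2 ⟨b, Finset.mem_erase.2 ⟨hbp, hbA⟩, by rw [hgb, hjp]⟩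
        rcases hit j hj with h | ⟨r, h⟩
        · refine Finset.mem_image.2 ⟨_, Finset.mem_erase.2 ⟨fun h' => ?_, h⟩, by simp [g, blk]⟩
          have := e.symm.injective h'
          simp at this
        · refine Finset.mem_image.2 ⟨_, Finset.mem_erase.2 ⟨fun h' => ?_, h⟩, by simp [g, blk]⟩
          have := Sum.inr_injective (e.symm.injective h')
          exact hjp (by rw [← this])
      have h2 := Finset.card_le_card this
      rw [Finset.card_image_of_injective _ (Option.some_injective _)] at h2
      have h3 := h2.trans Finset.card_image_le
      have h4 := Finset.card_erase_lt_of_mem ha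
      omega

/-- A connected graph `G` with `δ(G) ≥ 2` is `(γ,γ₂)`-perfect (every induced
subgraph of minimum degree at least 2 satisfies `γ = γ₂`) iff `G ∈ 𝒮`. -/
theorem stmt_14 {V : Type*} [Fintype V] (G : SimpleGraph V)
    (hconn : G.Connected) (hδ : ∀ x : V, 2 ≤ (G.neighborSet x).ncard) :
    (∀ s : Finset V,
        (∀ x : (↑s : Set V), 2 ≤ ((G.induce (↑s : Set V)).neighborSet x).ncard) →
        kDomNum (G.induce (↑s : Set V)) 1 = kDomNum (G.induce (↑s : Set V)) 2) ↔
      inS G := by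
  have hperf : (∀ s : Finset V,
        (∀ x : (↑s : Set V), 2 ≤ ((G.induce (↑s : Set V)).neighborSet x).ncard) →
        kDomNum (G.induce (↑s : Set V)) 1 = kDomNum (G.induce (↑s : Set V)) 2) ↔ Perf G := by
    constructor
    · intro h s hs
      exact (eq_iff_RD G s).1 (h s ((deg_iff G s).2 hs))
    · intro h s hs
      exact (eq_iff_RD G s).2 (h s ((deg_iff G s).1 hs))
  rw [hperf]
  constructor
  · intro hP
    have hd : RDeg G Finset.univ := by
      intro v _
      obtain ⟨a, b, ha, hb, hab⟩ := (Set.one_lt_ncard_iff (Set.toFinite _)).1 (hδ v)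
      exact ⟨a, Finset.mem_univ _, b, Finset.mem_univ _, hab, ha, hb⟩
    obtain ⟨D, hD⟩ := exists_good hP hd
    obtain ⟨c, hc, hcx⟩ := good_star hP hD hconn (fun v => by
      obtain ⟨a, -, -, -, -, h, -⟩ := hd v (Finset.mem_univ _)
      exact ⟨a, h⟩)
    exact inS_of_star hP hD hδ hc hcx
  · exact perf_of_S
end
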